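/- arXiv:1304.7385 — 2 statements merged into one kernel-verified Lean document; each statement's English description precedes it below -/
import Mathlib

section
/- Let X be a Hilbert space and let f : X → ℝ ∪ {+∞} be a proper lower semicontinuous function that is both prox-regular and subdifferentially continuous at x̄ for x̄* = 0 ∈ ∂f(x̄). Suppose there exist constants η > 0 and r ∈ [0, κ⁻¹) such that κ‖u*‖ ≥ ‖u‖ and ⟨u*, u⟩ ≥ −r‖u‖² whenever u* ∈ ∂̆²f(x, x*)(u) with (x, x*) ∈ gph ∂f ∩ B_η(x̄, 0). Then x̄ is a tilt-stable local minimizer of f with modulus κ. -/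
open Filter Metric Topology RealInnerProductSpace

noncomputable section

variable {X : Type*} [NormedAddCommGroup X] [InnerProductSpace ℝ X]

/-- The regular/Fréchet subdifferential of `f` at `x` (Hilbert-space setting). -/
def FrechetSubdiff (f : X → EReal) (x : X) : Set X :=
  {p | f x ≠ ⊤ ∧ ∀ ε : ℝ, 0 < ε → ∃ δ : ℝ, 0 < δ ∧
    ∀ y : X, ‖y - x‖ < δ → f x + ((⟪p, y - x⟫ - ε * ‖y - x‖ : ℝ) : EReal) ≤ f y}

/-- The limiting subdifferential of `f` at `x`: sequential weak outer limit of
Fréchet subdifferentials. -/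
def LimitingSubdiff (f : X → EReal) (x : X) : Set X :=
  {p | ∃ (xs ps : ℕ → X),
    (∀ k, ps k ∈ FrechetSubdiff f (xs k)) ∧
    Tendsto xs atTop (𝓝 x) ∧
    Tendsto (fun k => f (xs k)) atTop (𝓝 (f x)) ∧
    (∀ v : X, Tendsto (fun k => ⟪ps k, v⟫) atTop (𝓝 ⟪p, v⟫))}

def MetricallySubregularAt {A B : Type*} [PseudoMetricSpace A] [PseudoMetricSpace B]
    (F : A → Set B) (xb : A) (yb : B) (κ : ℝ) : Prop :=
  ∃ U ∈ 𝓝 xb, ∀ x ∈ U,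
    EMetric.infEdist x {z | yb ∈ F z} ≤ ENNReal.ofReal κ * EMetric.infEdist yb (F x)

def StronglyMetricallySubregularAt {A B : Type*} [PseudoMetricSpace A] [PseudoMetricSpace B]
    (F : A → Set B) (xb : A) (yb : B) (κ : ℝ) : Prop :=
  ∃ U ∈ 𝓝 xb, (∀ x ∈ U,
    EMetric.infEdist x {z | yb ∈ F z} ≤ ENNReal.ofReal κ * EMetric.infEdist yb (F x)) ∧
    {z | yb ∈ F z} ∩ U = {xb}

def MetricallyRegularAround {A B : Type*} [PseudoMetricSpace A] [PseudoMetricSpace B]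
    (F : A → Set B) (xb : A) (yb : B) (κ : ℝ) : Prop :=
  ∃ U ∈ 𝓝 xb, ∃ V ∈ 𝓝 yb, ∀ x ∈ U, ∀ y ∈ V,
    EMetric.infEdist x {z | y ∈ F z} ≤ ENNReal.ofReal κ * EMetric.infEdist y (F x)

def StronglyMetricallyRegularAround {A B : Type*} [PseudoMetricSpace A] [PseudoMetricSpace B]
    (F : A → Set B) (xb : A) (yb : B) (κ : ℝ) : Prop :=
  MetricallyRegularAround F xb yb κ ∧
  ∃ V ∈ 𝓝 yb, ∃ U ∈ 𝓝 xb, ∀ y ∈ V, ∃! x, x ∈ U ∧ y ∈ F x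

/-- `f` is subdifferentially continuous at `xb` for `pb`: the map `(x, p) ↦ f x` is
continuous at `(xb, pb)` relative to the graph of the limiting subdifferential. -/
def SubdiffContAt (f : X → EReal) (xb pb : X) : Prop :=
  Tendsto (fun q : X × X => f q.1)
    (𝓝[{q : X × X | q.2 ∈ LimitingSubdiff f q.1}] (xb, pb)) (𝓝 (f xb))

/-- `f` is prox-regular at `xb` for `pb`. -/
def ProxRegularAt (f : X → EReal) (xb pb : X) : Prop :=
  f xb ≠ ⊤ ∧ ∃ r : ℝ, 0 < r ∧ ∃ ε : ℝ, 0 < ε ∧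
    ∀ x ∈ Metric.closedBall xb ε, ∀ u ∈ Metric.closedBall xb ε,
      f u ≤ f xb + (ε : EReal) → f xb ≤ f u + (ε : EReal) →
      ∀ p ∈ LimitingSubdiff f u, p ∈ Metric.closedBall pb ε →
        f u + ((⟪p, x - u⟫ - r / 2 * ‖x - u‖ ^ 2 : ℝ) : EReal) ≤ f x

/-- The set of minimizers of the tilted function `x ↦ f x - ⟪p, x⟫` over the
closed ball of radius `γ` around `xb`. -/
def TiltArgmin (f : X → EReal) (xb : X) (γ : ℝ) (p : X) : Set X :=
  {x | x ∈ Metric.closedBall xb γ ∧ ∀ y ∈ Metric.closedBall xb γ,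
    f x - ((⟪p, x⟫ : ℝ) : EReal) ≤ f y - ((⟪p, y⟫ : ℝ) : EReal)}

/-- `xb` is a tilt-stable local minimizer of `f` with modulus `κ`. -/
def TiltStableWith (f : X → EReal) (xb : X) (κ : ℝ) : Prop :=
  ∃ γ : ℝ, 0 < γ ∧ ∃ V ∈ 𝓝 (0 : X), ∃ m : X → X,
    (∀ p ∈ V, TiltArgmin f xb γ p = {m p}) ∧
    LipschitzOnWith (Real.toNNReal κ) m V ∧ m 0 = xb

/-- `xb` is a tilt-stable local minimizer of `f`. -/
def TiltStable (f : X → EReal) (xb : X) : Prop :=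
  ∃ γ : ℝ, 0 < γ ∧ ∃ V ∈ 𝓝 (0 : X), ∃ m : X → X, ∃ K : NNReal,
    (∀ p ∈ V, TiltArgmin f xb γ p = {m p}) ∧
    LipschitzOnWith K m V ∧ m 0 = xb

/-- The Fréchet/regular normal cone to a subset of `X × X` at a point. -/
def FrechetNormalP (Ω : Set (X × X)) (zb : X × X) : Set (X × X) :=
  {w | ∀ ε : ℝ, 0 < ε → ∃ δ : ℝ, 0 < δ ∧ ∀ z ∈ Ω, dist z zb < δ →
    ⟪w.1, z.1 - zb.1⟫ + ⟪w.2, z.2 - zb.2⟫ ≤ ε * dist z zb}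

/-- The combined second-order subdifferential of `f` at `x` for `p ∈ ∂f(x)`:
the regular coderivative of the limiting subdifferential mapping. -/
def CombinedSecondSubdiff (f : X → EReal) (x p u : X) : Set X :=
  {w | (w, -u) ∈ FrechetNormalP {q : X × X | q.2 ∈ LimitingSubdiff f q.1} (x, p)}


/-- A smooth variational principle of Borwein-Preiss type. -/
lemma smooth_vp [CompleteSpace X] (C : Set X) (hC : IsClosed C) (D : ℝ)
    (hD : ∀ x ∈ C, ∀ y ∈ C, ‖x - y‖ ≤ D) (x0 : X) (hx0 : x0 ∈ C) (g : X → ℝ)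
    (hg : LowerSemicontinuousOn g C) (B : ℝ) (hB : ∀ x ∈ C, B ≤ g x) (ε : ℝ) (hε : 0 < ε) :
    ∃ q ∈ C, ∃ v : X, ‖v‖ ≤ ε ∧
      ∀ x ∈ C, g q ≤ g x + ⟪v, x - q⟫ + ε * ‖x - q‖ ^ 2 := by
  have hD0 : 0 ≤ D := by simpa using hD x0 hx0 x0 hx0
  -- choice of almost minimizers
  have hpick : ∀ (P : X → ℝ) (y : X) (d : ℝ), ∃ y' : X, y ∈ C → (∀ x, 0 ≤ P x) → 0 < d →
      (y' ∈ C ∧ g y' + P y' ≤ g y + P y ∧ ∀ x ∈ C, g y' + P y' ≤ g x + P x + d) := by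
    intro P y d
    by_cases hh : y ∈ C ∧ (∀ x, 0 ≤ P x) ∧ 0 < d
    · obtain ⟨hy, hP, hd⟩ := hh
      set S := (fun x => g x + P x) '' C with hS
      have hSne : S.Nonempty := ⟨_, y, hy, rfl⟩
      have hSb : BddBelow S := ⟨B, by
        rintro _ ⟨x, hx, rfl⟩
        have := hB x hx
        have := hP x
        simp only
        linarith⟩
      by_cases hc : g y + P y ≤ sInf S + d
      · refine ⟨y, fun _ _ _ => ⟨hy, le_rfl, fun x hx => ?_⟩⟩
        have : sInf S ≤ g x + P x := csInf_le hSb ⟨x, hx, rfl⟩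
        linarith
      · obtain ⟨_, ⟨y', hy', rfl⟩, hlt⟩ := exists_lt_of_csInf_lt hSne
          (show sInf S < sInf S + d by linarith)
        simp only at hlt
        refine ⟨y', fun _ _ _ => ⟨hy', by linarith, fun x hx => ?_⟩⟩
        have : sInf S ≤ g x + P x := csInf_le hSb ⟨x, hx, rfl⟩
        linarith
    · refine ⟨y, fun h1 h2 h3 => absurd ⟨h1, h2, h3⟩ hh⟩
  choose pick hpick using hpick
  set e0 : ℝ := ε / (1 + 2 * D) with he0
  have he0pos : 0 < e0 := by positivity
  have he0le : e0 ≤ ε := by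
    rw [he0, div_le_iff₀ (by positivity)]
    nlinarith
  have he0D : e0 * (2 * D) ≤ ε := by
    rw [he0, div_mul_eq_mul_div, div_le_iff₀ (by positivity)]
    nlinarith
  let e : ℕ → ℝ := fun n => e0 / 2 / 2 ^ n
  have hepos : ∀ n, 0 < e n := fun n => by positivity
  have hesum : HasSum e e0 := hasSum_geometric_two' e0
  let d : ℕ → ℝ := fun n => e n * ((1 / 2 : ℝ) ^ n) ^ 2
  have hdpos : ∀ n, 0 < d n := fun n => by positivity
  let st : ℕ → X × (X → ℝ) := fun n => Nat.rec (pick 0 x0 (d 0), 0)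
    (fun n s => (pick (fun x => s.2 x + e n * ‖x - s.1‖ ^ 2) s.1 (d (n + 1)),
      fun x => s.2 x + e n * ‖x - s.1‖ ^ 2)) n
  let xs : ℕ → X := fun n => (st n).1
  let P : ℕ → X → ℝ := fun n => (st n).2
  have hP0 : ∀ x, P 0 x = 0 := fun x => rfl
  have hPs : ∀ n x, P (n + 1) x = P n x + e n * ‖x - xs n‖ ^ 2 := fun n x => rfl
  have hxs0 : xs 0 = pick (P 0) x0 (d 0) := rfl
  have hxss : ∀ n, xs (n + 1) = pick (P (n + 1)) (xs n) (d (n + 1)) := fun n => rfl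
  clear_value xs P
  have hPnn : ∀ n x, 0 ≤ P n x := by
    intro n
    induction n with
    | zero => intro x; rw [hP0]
    | succ n ih =>
      intro x
      rw [hPs]
      have := ih x
      have := (hepos n).le
      positivity
  have hxC : ∀ n, xs n ∈ C := by
    intro n
    induction n with
    | zero => rw [hxs0]; exact (hpick _ _ _ hx0 (hPnn 0) (hdpos 0)).1
    | succ n ih => rw [hxss]; exact (hpick _ _ _ ih (hPnn _) (hdpos _)).1
  have hmin : ∀ n, ∀ x ∈ C, g (xs n) + P n (xs n) ≤ g x + P n x + d n := by
    intro n
    cases n with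
    | zero => rw [hxs0]; exact (hpick _ _ _ hx0 (hPnn 0) (hdpos 0)).2.2
    | succ n => rw [hxss]; exact (hpick _ _ _ (hxC n) (hPnn _) (hdpos _)).2.2
  have hdec : ∀ n, g (xs (n + 1)) + P (n + 1) (xs (n + 1)) ≤ g (xs n) + P n (xs n) := by
    intro n
    have h := (hpick (P (n + 1)) (xs n) (d (n + 1)) (hxC n) (hPnn _) (hdpos _)).2.1
    rw [← hxss, hPs n (xs n)] at h
    simpa using h
  have hPcont : ∀ n, Continuous (P n) := by
    intro n
    induction n with
    | zero =>
      have : P 0 = fun _ => 0 := funext hP0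
      rw [this]; exact continuous_const
    | succ n ih =>
      have : P (n + 1) = fun x => P n x + e n * ‖x - xs n‖ ^ 2 := funext (hPs n)
      rw [this]; fun_prop
  -- nestedness
  have hnest : ∀ n m, n ≤ m → ∀ x, g x + P (m + 1) x ≤ g (xs m) + P m (xs m) →
      g x + P (n + 1) x ≤ g (xs n) + P n (xs n) := by
    intro n m hnm
    induction m, hnm using Nat.le_induction with
    | base => intro x h; exact h
    | succ m hm ih =>
      intro x h
      apply ih
      have h1 := hdec m
      have h2 := hPs (m + 1) x
      have : 0 ≤ e (m + 1) * ‖x - xs (m + 1)‖ ^ 2 := by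
        have := (hepos (m + 1)).le
        positivity
      linarith
  have hS : ∀ n m, n < m → g (xs m) + P (n + 1) (xs m) ≤ g (xs n) + P n (xs n) := by
    intro n m hnm
    obtain ⟨k, rfl⟩ : ∃ k, m = k + 1 := ⟨m - 1, by omega⟩
    exact hnest n k (by omega) _ (hdec k)
  have hclose : ∀ n, dist (xs n) (xs (n + 1)) ≤ 1 * (1 / 2 : ℝ) ^ n := by
    intro n
    have h1 := hS n (n + 1) (by omega)
    have h2 := hmin n (xs (n + 1)) (hxC _)
    rw [hPs] at h1
    have h3 : e n * ‖xs (n + 1) - xs n‖ ^ 2 ≤ e n * ((1 / 2 : ℝ) ^ n) ^ 2 := by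
      change _ ≤ d n
      linarith
    have h4 := le_of_mul_le_mul_left h3 (hepos n)
    rw [dist_comm, dist_eq_norm, one_mul]
    exact le_of_sq_le_sq h4 (by positivity)
  have hcau : CauchySeq xs := cauchySeq_of_le_geometric _ _ (by norm_num) hclose
  obtain ⟨q, hq⟩ := cauchySeq_tendsto_of_complete hcau
  have hqC : q ∈ C := hC.mem_of_tendsto hq (Eventually.of_forall hxC)
  have hqS : ∀ n, g q + P (n + 1) q ≤ g (xs n) + P n (xs n) := by
    intro n
    by_contra hcon
    push Not at hcon
    have hl : LowerSemicontinuousOn (fun x => g x + P (n + 1) x) C :=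
      hg.add ((hPcont _).lowerSemicontinuous.lowerSemicontinuousOn _)
    have h1 := hl q hqC _ hcon
    have h2 : Tendsto xs atTop (𝓝[C] q) :=
      tendsto_nhdsWithin_iff.2 ⟨hq, Eventually.of_forall hxC⟩
    obtain ⟨m, hm1, hm2⟩ := ((h2.eventually h1).and (eventually_gt_atTop n)).exists
    have := hS n m hm2
    linarith
  have hPsum : ∀ n x, P n x = P n q + (∑ k ∈ Finset.range n, e k) * ‖x - q‖ ^ 2
      + ⟪∑ k ∈ Finset.range n, (2 * e k) • (q - xs k), x - q⟫ := by
    intro n x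
    induction n with
    | zero => simp [hP0]
    | succ n ih =>
      rw [hPs, hPs, ih, Finset.sum_range_succ, Finset.sum_range_succ, inner_add_left,
        inner_smul_left]
      have : ‖x - xs n‖ ^ 2 = ‖x - q‖ ^ 2 + 2 * ⟪q - xs n, x - q⟫ + ‖q - xs n‖ ^ 2 := by
        have h : x - xs n = (q - xs n) + (x - q) := by abel
        rw [h, norm_add_sq_real]; ring
      rw [this]
      simp
      ring
  have hnb : ∀ k, ‖(2 * e k) • (q - xs k)‖ ≤ e k * (2 * D) := by
    intro k
    rw [norm_smul, Real.norm_of_nonneg (by have := (hepos k).le; positivity)]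
    have := hD q hqC (xs k) (hxC k)
    have := hepos k
    nlinarith
  have hbs : HasSum (fun k => e k * (2 * D)) (e0 * (2 * D)) := hesum.mul_right _
  have hsm : Summable (fun k => (2 * e k) • (q - xs k)) :=
    Summable.of_norm_bounded hbs.summable hnb
  refine ⟨q, hqC, ∑' k, (2 * e k) • (q - xs k), (tsum_of_norm_bounded hbs hnb).trans he0D, ?_⟩
  intro x hx
  have hlim : Tendsto (fun n => g x + (∑ k ∈ Finset.range n, e k) * ‖x - q‖ ^ 2
      + ⟪∑ k ∈ Finset.range n, (2 * e k) • (q - xs k), x - q⟫ + d n) atTop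
      (𝓝 (g x + e0 * ‖x - q‖ ^ 2 + ⟪∑' k, (2 * e k) • (q - xs k), x - q⟫ + 0)) := by
    refine Tendsto.add (Tendsto.add (Tendsto.add tendsto_const_nhds ?_) ?_) ?_
    · exact hesum.tendsto_sum_nat.mul_const _
    · exact hsm.hasSum.tendsto_sum_nat.inner tendsto_const_nhds
    · have h1 : Tendsto e atTop (𝓝 0) := hesum.summable.tendsto_atTop_zero
      refine squeeze_zero (fun n => (hdpos n).le) (fun n => ?_) h1
      have : ((1 / 2 : ℝ) ^ n) ^ 2 ≤ 1 := pow_le_one₀ (by positivity)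
        (pow_le_one₀ (by norm_num) (by norm_num))
      have := hepos n
      change e n * _ ≤ e n
      nlinarith
  have hle : ∀ n, g q ≤ g x + (∑ k ∈ Finset.range n, e k) * ‖x - q‖ ^ 2
      + ⟪∑ k ∈ Finset.range n, (2 * e k) • (q - xs k), x - q⟫ + d n := by
    intro n
    have h1 := hqS n
    have h2 := hmin n x hx
    have h3 := hPsum n x
    rw [hPs] at h1
    have : 0 ≤ e n * ‖q - xs n‖ ^ 2 := by
      have := (hepos n).le
      positivity
    linarith
  have := ge_of_tendsto' hlim hle
  nlinarith [sq_nonneg ‖x - q‖]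

/-- Fuzzy mean value: a large increment forces a large proximal supergradient. -/
lemma fuzzy_mvt [CompleteSpace X] (ψ : X → ℝ) (a b : X) (m K θ ρ : ℝ) (hm : 0 ≤ m) (hK : 0 ≤ K)
    (hθ : 0 < θ) (hab : a ≠ b) (hρ : (K / θ + 1) * ‖b - a‖ ≤ ρ)
    (hcont : ContinuousOn ψ (closedBall a ρ))
    (hlip : ∀ x ∈ closedBall a ρ, |ψ x - ψ a| ≤ K * ‖x - a‖)
    (hgap : (m + 3 * θ) * ‖b - a‖ ≤ ψ b - ψ a) :
    ∃ q ∈ ball a ρ, ∃ u : X, m ≤ ‖u‖ ∧ ∃ A : ℝ, 0 ≤ A ∧ ∃ τ : ℝ, 0 < τ ∧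
      ∀ x, ‖x - q‖ < τ → ψ x ≤ ψ q + ⟪u, x - q⟫ + A * ‖x - q‖ ^ 2 := by
  set l := ‖b - a‖ with hl
  have hlpos : 0 < l := norm_pos_iff.2 (sub_ne_zero.2 hab.symm)
  have hKθ : 0 ≤ K / θ := by positivity
  have hρl : l ≤ ρ := by nlinarith
  have hρpos : 0 < ρ := by linarith
  set ε := min θ (θ * l / (2 * (2 * ρ + (2 * ρ) ^ 2))) with hεdef
  have hε : 0 < ε := by positivity
  have hεθ : ε ≤ θ := min_le_left _ _
  have hερ : ε * (2 * ρ + (2 * ρ) ^ 2) < θ * l := by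
    have h1 : ε ≤ θ * l / (2 * (2 * ρ + (2 * ρ) ^ 2)) := min_le_right _ _
    rw [le_div_iff₀ (by positivity)] at h1
    have : 0 < θ * l := by positivity
    linarith
  have hbC : b ∈ closedBall a ρ := by rw [mem_closedBall, dist_eq_norm]; exact hρl
  have haC : a ∈ closedBall a ρ := mem_closedBall_self hρpos.le
  have hdiam : ∀ x ∈ closedBall a ρ, ∀ y ∈ closedBall a ρ, ‖x - y‖ ≤ 2 * ρ := by
    intro x hx y hy
    rw [← dist_eq_norm]
    have := dist_triangle_right x y a
    rw [mem_closedBall] at hx hy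
    linarith
  let Φ : X → ℝ := fun x => (m + θ) * ‖x - a‖ + θ / l * ‖x - a‖ ^ 2
  have hΦnn : ∀ x, 0 ≤ Φ x := fun x => by positivity
  have hΦc : Continuous Φ := by fun_prop
  obtain ⟨q, hqC, v, hv, hq⟩ := smooth_vp (closedBall a ρ) isClosed_closedBall (2 * ρ) hdiam a haC
    (fun x => Φ x - ψ x) ((hΦc.continuousOn.sub hcont).lowerSemicontinuousOn) (-ψ a - K * ρ)
    (by
      intro x hx
      have h1 := (abs_le.1 (hlip x hx)).2
      have h2 := hΦnn x
      rw [mem_closedBall, dist_eq_norm] at hx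
      nlinarith) ε hε
  have hb := hq b hbC
  have hbq := hdiam b hbC q hqC
  have hin : ⟪v, b - q⟫ ≤ ε * (2 * ρ) :=
    (real_inner_le_norm _ _).trans (mul_le_mul hv hbq (norm_nonneg _) hε.le)
  have hsq : ε * ‖b - q‖ ^ 2 ≤ ε * (2 * ρ) ^ 2 := by gcongr
  have hΦb : Φ b = (m + 2 * θ) * l := by
    change (m + θ) * l + θ / l * l ^ 2 = _
    field_simp
    ring
  have hgt : Φ q < ψ q - ψ a := by
    nlinarith
  set s := ‖q - a‖ with hs
  have hqa : q ≠ a := by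
    rintro rfl
    have := hΦnn q
    simp at hgt
    linarith
  have hspos : 0 < s := norm_pos_iff.2 (sub_ne_zero.2 hqa)
  have hsl : s < ρ := by
    have h1 := (abs_le.1 (hlip q hqC)).2
    have h2 : (m + θ) * s + θ / l * s ^ 2 < K * s := lt_of_lt_of_le hgt h1
    have h3 : θ / l * s < K := by
      have : (θ / l * s) * s < K * s := by
        have : 0 ≤ (m + θ) * s := by positivity
        nlinarith
      exact lt_of_mul_lt_mul_right this hspos.le
    have h4 : s < K / θ * l := by
      rw [div_mul_eq_mul_div, lt_div_iff₀ hθ]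
      rw [div_mul_eq_mul_div, div_lt_iff₀ hlpos] at h3
      linarith
    nlinarith
  refine ⟨q, by rw [mem_ball, dist_eq_norm]; exact hsl,
    ((m + θ) / s + 2 * (θ / l)) • (q - a) + v, ?_, (m + θ) / (2 * s) + θ / l + ε, by positivity,
    ρ - s, by linarith, ?_⟩
  · have h1 : ‖((m + θ) / s + 2 * (θ / l)) • (q - a)‖ = (m + θ) + 2 * (θ / l) * s := by
      rw [norm_smul, Real.norm_of_nonneg (by positivity), ← hs]
      field_simp
    have h2 := norm_sub_le_norm_add (((m + θ) / s + 2 * (θ / l)) • (q - a)) v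
    have : 0 ≤ 2 * (θ / l) * s := by positivity
    linarith
  · intro x hx
    have hxC : x ∈ closedBall a ρ := by
      rw [mem_closedBall, dist_eq_norm]
      have := norm_add_le (x - q) (q - a)
      rw [sub_add_sub_cancel] at this
      linarith
    have h1 := hq x hxC
    have hexp : ‖x - a‖ ^ 2 = ‖x - q‖ ^ 2 + 2 * ⟪q - a, x - q⟫ + s ^ 2 := by
      have h : x - a = (q - a) + (x - q) := by abel
      rw [h, norm_add_sq_real]; ring
    have hn : ‖x - a‖ ≤ s + ⟪q - a, x - q⟫ / s + ‖x - q‖ ^ 2 / (2 * s) := by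
      have : s + ⟪q - a, x - q⟫ / s + ‖x - q‖ ^ 2 / (2 * s) = (‖x - a‖ ^ 2 + s ^ 2) / (2 * s) := by
        rw [hexp]; field_simp; ring
      rw [this, le_div_iff₀ (by positivity)]
      nlinarith [sq_nonneg (‖x - a‖ - s)]
    have hn2 : (m + θ) * ‖x - a‖ ≤
        (m + θ) * (s + ⟪q - a, x - q⟫ / s + ‖x - q‖ ^ 2 / (2 * s)) := by gcongr
    have hΦx : Φ x = (m + θ) * ‖x - a‖ + θ / l * ‖x - a‖ ^ 2 := rfl
    have hΦq : Φ q = (m + θ) * s + θ / l * s ^ 2 := rfl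
    rw [inner_add_left, inner_smul_left]
    simp only [conj_trivial] at *
    rw [hexp] at hΦx
    have e1 : ((m + θ) / s + 2 * (θ / l)) * ⟪q - a, x - q⟫ =
      (m + θ) * (⟪q - a, x - q⟫ / s) + 2 * (θ / l) * ⟪q - a, x - q⟫ := by ring
    have e2 : ((m + θ) / (2 * s) + θ / l + ε) * ‖x - q‖ ^ 2 =
      (m + θ) * (‖x - q‖ ^ 2 / (2 * s)) + θ / l * ‖x - q‖ ^ 2 + ε * ‖x - q‖ ^ 2 := by ring
    rw [e1, e2]
    linarith

/-- Chaining: a Lipschitz bound at small scale on a ball holds at every scale. -/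
lemma lip_chain (R : X → X) (ρ τ m : ℝ) (hτ : 0 < τ)
    (h : ∀ x ∈ closedBall (0 : X) ρ, ∀ y ∈ closedBall (0 : X) ρ, ‖y - x‖ ≤ τ →
      ‖R y - R x‖ ≤ m * ‖y - x‖) :
    ∀ x ∈ closedBall (0 : X) ρ, ∀ y ∈ closedBall (0 : X) ρ, ‖R y - R x‖ ≤ m * ‖y - x‖ := by
  intro x hx y hy
  obtain ⟨n, hn⟩ := exists_nat_gt (‖y - x‖ / τ)
  have hn0 : (0 : ℝ) < n := lt_of_le_of_lt (by positivity) hn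
  let p : ℕ → X := fun k => x + ((k : ℝ) / n) • (y - x)
  have hpm : ∀ k, k ≤ n → p k ∈ closedBall (0 : X) ρ := by
    intro k hk
    apply (convex_closedBall (0 : X) ρ).add_smul_sub_mem hx hy
    constructor
    · positivity
    · rw [div_le_one hn0]; exact_mod_cast hk
  have hps : ∀ k, ‖p (k + 1) - p k‖ = ‖y - x‖ / n := by
    intro k
    have : p (k + 1) - p k = (1 / (n : ℝ)) • (y - x) := by
      simp only [p]
      rw [add_sub_add_left_eq_sub, ← sub_smul]
      congr 1
      push_cast
      ring
    rw [this, norm_smul, Real.norm_of_nonneg (by positivity)]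
    ring
  have key : ∀ k, k ≤ n → ‖R (p k) - R x‖ ≤ m * (k * (‖y - x‖ / n)) := by
    intro k
    induction k with
    | zero => intro _; simp [p]
    | succ k ih =>
      intro hk
      have h1 := ih (by omega)
      have h2 := h (p k) (hpm k (by omega)) (p (k + 1)) (hpm _ hk) (by
        rw [hps, div_le_iff₀ hn0]
        rw [div_lt_iff₀ hτ] at hn
        linarith)
      rw [hps] at h2
      have h3 := norm_add_le (R (p (k + 1)) - R (p k)) (R (p k) - R x)
      rw [sub_add_sub_cancel] at h3
      push_cast
      nlinarith
  have := key n le_rfl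
  have hpn : p n = y := by
    simp only [p]
    rw [div_self hn0.ne', one_smul]; abel
  rw [hpn] at this
  rwa [mul_div_cancel₀ _ hn0.ne'] at this

/-- Descent lemma for subgradient selections. -/
lemma descent (R : X → X) (φ : X → ℝ) (S : Set X) (hS : Convex ℝ S) (L : ℝ)
    (hφ : ∀ q ∈ S, ∀ q' ∈ S, φ q + ⟪R q, q' - q⟫ ≤ φ q')
    (hL : ∀ q ∈ S, ∀ q' ∈ S, ‖R q' - R q‖ ≤ L * ‖q' - q‖) :
    ∀ q ∈ S, ∀ q' ∈ S, φ q' ≤ φ q + ⟪R q, q' - q⟫ + L / 2 * ‖q' - q‖ ^ 2 := by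
  intro x hx y hy
  have main : ∀ n : ℕ, φ y ≤ φ x + ⟪R x, y - x⟫ +
      (L / 2 * ‖y - x‖ ^ 2 + (L / 2 * ‖y - x‖ ^ 2) * (1 / ((n : ℝ) + 1))) := by
    intro n
    set N : ℝ := (n : ℝ) + 1 with hN
    have hn0 : 0 < N := by positivity
    let p : ℕ → X := fun k => x + ((k : ℝ) / N) • (y - x)
    have hpm : ∀ k, k ≤ n + 1 → p k ∈ S := by
      intro k hk
      apply hS.add_smul_sub_mem hx hy
      constructor
      · positivity
      · rw [div_le_one hn0, hN]; exact_mod_cast hk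
    have key : ∀ k, k ≤ n + 1 → φ (p k) ≤ φ x + (k / N) * ⟪R x, y - x⟫ +
        L * ‖y - x‖ ^ 2 * ((k * (k + 1)) / (2 * N ^ 2)) := by
      intro k
      induction k with
      | zero => intro _; simp [p]
      | succ k ih =>
        intro hk
        have h1 := ih (by omega)
        have hm1 := hpm (k + 1) hk
        have h2 := hφ (p (k + 1)) hm1 (p k) (hpm k (by omega))
        have h3 : p k - p (k + 1) = -((1 / N) • (y - x)) := by
          simp only [p]
          rw [add_sub_add_left_eq_sub, ← sub_smul, ← neg_smul]
          congr 1
          push_cast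
          ring
        rw [h3, inner_neg_right, inner_smul_right] at h2
        have h4 := hL x hx (p (k + 1)) hm1
        have h5 : ‖p (k + 1) - x‖ = ((k : ℝ) + 1) / N * ‖y - x‖ := by
          simp only [p]
          rw [add_sub_cancel_left, norm_smul, Real.norm_of_nonneg (by positivity)]
          push_cast
          ring
        rw [h5] at h4
        have h6 : ⟪R (p (k + 1)) - R x, y - x⟫ ≤ L * (((k : ℝ) + 1) / N * ‖y - x‖) * ‖y - x‖ :=
          (real_inner_le_norm _ _).trans (mul_le_mul_of_nonneg_right h4 (norm_nonneg _))
        rw [inner_sub_left] at h6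
        have h7 : 1 / N * ⟪R (p (k + 1)), y - x⟫ ≤ 1 / N * (⟪R x, y - x⟫ +
            L * (((k : ℝ) + 1) / N * ‖y - x‖) * ‖y - x‖) := by
          apply mul_le_mul_of_nonneg_left _ (by positivity)
          linarith
        push_cast
        have e1 : φ x + ((k : ℝ) + 1) / N * ⟪R x, y - x⟫ +
            L * ‖y - x‖ ^ 2 * (((k : ℝ) + 1) * (k + 1 + 1) / (2 * N ^ 2)) =
            (φ x + (k / N) * ⟪R x, y - x⟫ + L * ‖y - x‖ ^ 2 * ((k * (k + 1)) / (2 * N ^ 2))) +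
            1 / N * (⟪R x, y - x⟫ + L * (((k : ℝ) + 1) / N * ‖y - x‖) * ‖y - x‖) := by
          field_simp
          ring
        rw [e1]
        linarith
    have h := key (n + 1) le_rfl
    have hpn : p (n + 1) = y := by
      simp only [p]
      push_cast
      rw [← hN, div_self hn0.ne', one_smul]; abel
    rw [hpn] at h
    push_cast at h
    rw [← hN] at h
    have e : φ x + N / N * ⟪R x, y - x⟫ + L * ‖y - x‖ ^ 2 * (N * (N + 1) / (2 * N ^ 2)) =
        φ x + ⟪R x, y - x⟫ + (L / 2 * ‖y - x‖ ^ 2 + (L / 2 * ‖y - x‖ ^ 2) * (1 / N)) := by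
      field_simp
    rwa [e] at h
  have hlim : Tendsto (fun n : ℕ => φ x + ⟪R x, y - x⟫ +
      (L / 2 * ‖y - x‖ ^ 2 + (L / 2 * ‖y - x‖ ^ 2) * (1 / ((n : ℝ) + 1)))) atTop
      (𝓝 (φ x + ⟪R x, y - x⟫ + (L / 2 * ‖y - x‖ ^ 2 + (L / 2 * ‖y - x‖ ^ 2) * 0))) :=
    ((tendsto_one_div_add_atTop_nhds_zero_nat.const_mul _).const_add _).const_add _
  have := ge_of_tendsto' hlim main
  linarith

/-- Local cocoercivity (Baillon-Haddad) with room. -/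
lemma cocoercive (R : X → X) (φ : X → ℝ) (S : Set X) (hS : Convex ℝ S) (L : ℝ) (hLpos : 0 < L)
    (hφ : ∀ q ∈ S, ∀ q' ∈ S, φ q + ⟪R q, q' - q⟫ ≤ φ q')
    (hL : ∀ q ∈ S, ∀ q' ∈ S, ‖R q' - R q‖ ≤ L * ‖q' - q‖) (q₁ q₂ : X) (h₁ : q₁ ∈ S) (h₂ : q₂ ∈ S)
    (h₃ : q₂ - (1 / L) • (R q₂ - R q₁) ∈ S) (h₄ : q₁ + (1 / L) • (R q₂ - R q₁) ∈ S) :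
    ‖R q₂ - R q₁‖ ^ 2 ≤ L * ⟪R q₂ - R q₁, q₂ - q₁⟫ := by
  have d1 := descent R φ S hS L hφ hL q₂ h₂ _ h₃
  have d2 := descent R φ S hS L hφ hL q₁ h₁ _ h₄
  have s1 := hφ q₁ h₁ _ h₃
  have s2 := hφ q₂ h₂ _ h₄
  set w := R q₂ - R q₁ with hw
  have e1 : q₂ - (1 / L) • w - q₂ = -((1 / L) • w) := by abel
  have e2 : q₁ + (1 / L) • w - q₁ = (1 / L) • w := by abel
  have e3 : q₂ - (1 / L) • w - q₁ = (q₂ - q₁) - (1 / L) • w := by abel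
  have e4 : q₁ + (1 / L) • w - q₂ = -(q₂ - q₁) + (1 / L) • w := by abel
  rw [e1, inner_neg_right, norm_neg, inner_smul_right, norm_smul,
    Real.norm_of_nonneg (by positivity)] at d1
  rw [e2, inner_smul_right, norm_smul, Real.norm_of_nonneg (by positivity)] at d2
  rw [e3, inner_sub_right, inner_smul_right] at s1
  rw [e4, inner_add_right, inner_neg_right, inner_smul_right] at s2
  have hww : ‖w‖ ^ 2 = ⟪R q₂, w⟫ - ⟪R q₁, w⟫ := by
    rw [← inner_sub_left, ← hw, real_inner_self_eq_norm_sq]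
  have hwq : ⟪w, q₂ - q₁⟫ = ⟪R q₂, q₂ - q₁⟫ - ⟪R q₁, q₂ - q₁⟫ := by
    rw [hw, inner_sub_left]
  have e5 : L / 2 * (1 / L * ‖w‖) ^ 2 = 1 / L * ‖w‖ ^ 2 / 2 := by field_simp
  have : 1 / L * ‖w‖ ^ 2 ≤ ⟪w, q₂ - q₁⟫ := by
    rw [e5] at d1 d2
    have hww' : 1 / L * ‖w‖ ^ 2 = 1 / L * ⟪R q₂, w⟫ - 1 / L * ⟪R q₁, w⟫ := by rw [hww]; ring
    linarith
  rw [div_mul_eq_mul_div, div_le_iff₀ hLpos] at this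
  linarith

lemma hilb_ineq (z u D : X) (L s : ℝ) (hL : 0 < L) (hz : ‖z‖ = 1) (hu : 0 < ‖u‖)
    (hus : s ≤ ‖u‖) (hD : ‖D‖ ≤ L) (hzD : ⟪z, D⟫ ≤ -(‖u‖ - s))
    (hco : ‖D‖ ^ 2 ≤ L * ⟪D, -((1 / ‖u‖) • u)⟫) :
    ‖u‖ ≤ L + s ∧ (‖u‖ - s) ^ 2 / L - √(L ^ 2 - ‖u‖ ^ 2 + 2 * ‖u‖ * s) ≤ ⟪z, u⟫ := by
  set M := ‖u‖ with hM
  set v := -((1 / M) • u) with hv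
  have hvn : ‖v‖ = 1 := by
    rw [hv, norm_neg, norm_smul, Real.norm_of_nonneg (by positivity), ← hM]
    field_simp
  have h1 : M - s ≤ ‖D‖ := by
    have := abs_le.1 (abs_real_inner_le_norm z D)
    rw [hz, one_mul] at this
    linarith
  refine ⟨by linarith, ?_⟩
  have h2 : (M - s) ^ 2 / L ≤ ⟪D, v⟫ := by
    rw [div_le_iff₀ hL]
    have : (M - s) ^ 2 ≤ ‖D‖ ^ 2 := by
      apply pow_le_pow_left₀ (by linarith) h1
    linarith
  have h3 : ‖D + M • z‖ ≤ √(L ^ 2 - M ^ 2 + 2 * M * s) := by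
    apply Real.le_sqrt_of_sq_le
    rw [norm_add_sq_real, inner_smul_right, norm_smul, hz, Real.norm_of_nonneg hu.le,
      real_inner_comm]
    have : ‖D‖ ^ 2 ≤ L ^ 2 := pow_le_pow_left₀ (norm_nonneg _) hD 2
    nlinarith
  have h4 : ⟪D + M • z, v⟫ ≤ √(L ^ 2 - M ^ 2 + 2 * M * s) := by
    have := real_inner_le_norm (D + M • z) v
    rw [hvn, mul_one] at this
    linarith
  have h5 : ⟪D + M • z, v⟫ = ⟪D, v⟫ - ⟪z, u⟫ := by
    rw [inner_add_left, inner_smul_left, hv, inner_neg_right, inner_neg_right, inner_smul_right,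
      inner_smul_right]
    simp only [conj_trivial]
    field_simp
    ring
  linarith

lemma boot_step [CompleteSpace X] (R : X → X) (φ : X → ℝ) (δ : ℝ)
    (hφ : ∀ q ∈ ball (0 : X) δ, ∀ q' ∈ ball (0 : X) δ, φ q + ⟪R q, q' - q⟫ ≤ φ q')
    (L s : ℝ) (hs : 0 < s) (hsL : 3 * s < L)
    (hL : ∀ q ∈ ball (0 : X) δ, ∀ q' ∈ ball (0 : X) δ, ‖R q' - R q‖ ≤ L * ‖q' - q‖)
    (a b : X) (ha : a ∈ ball (0 : X) δ) (hb : b ∈ ball (0 : X) δ)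
    (hab : (L - s) * ‖b - a‖ < ‖R b - R a‖) :
    ∃ q ∈ ball (0 : X) δ, ∃ z u : X, ‖z‖ = 1 ∧ L - 2 * s ≤ ‖u‖ ∧ ‖u‖ ≤ L + s ∧
      (‖u‖ - s) ^ 2 / L - √(L ^ 2 - ‖u‖ ^ 2 + 2 * ‖u‖ * s) ≤ ⟪z, u⟫ ∧
      ∃ A : ℝ, 0 ≤ A ∧ ∃ τ : ℝ, 0 < τ ∧
        ∀ x, ‖x - q‖ < τ → ⟪z, R x - R q⟫ ≤ ⟪u, x - q⟫ + A * ‖x - q‖ ^ 2 := by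
  have hLpos : 0 < L := by linarith
  set ρ' := max ‖a‖ ‖b‖ with hρ'
  rw [mem_ball_zero_iff] at ha hb
  have hρδ : ρ' < δ := max_lt ha hb
  set M := L / (s / 3) + 1 with hM
  have hMpos : 0 < M := by positivity
  set τ0 := (δ - ρ') / (2 * M) with hτ0
  have hτ0pos : 0 < τ0 := div_pos (by linarith) (by positivity)
  obtain ⟨x, hx, y, hy, hxy, hgap⟩ : ∃ x ∈ closedBall (0 : X) ρ', ∃ y ∈ closedBall (0 : X) ρ',
      ‖y - x‖ ≤ τ0 ∧ (L - s) * ‖y - x‖ < ‖R y - R x‖ := by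
    by_contra hcon
    push Not at hcon
    have := lip_chain R ρ' τ0 (L - s) hτ0pos hcon a
      (mem_closedBall_zero_iff.2 (le_max_left _ _)) b
      (mem_closedBall_zero_iff.2 (le_max_right _ _))
    linarith
  set w := R y - R x with hw
  have hwpos : 0 < ‖w‖ := lt_of_le_of_lt (mul_nonneg (by linarith) (norm_nonneg _)) hgap
  have hne : x ≠ y := by
    rintro rfl
    rw [hw, sub_self, norm_zero] at hwpos
    exact lt_irrefl _ hwpos
  set z := (1 / ‖w‖) • w with hz
  have hzn : ‖z‖ = 1 := by
    rw [hz, norm_smul, Real.norm_of_nonneg (by positivity)]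
    field_simp
  have hsub : closedBall x (M * ‖y - x‖) ⊆ ball (0 : X) δ := by
    intro p hp
    rw [mem_closedBall, dist_eq_norm] at hp
    rw [mem_closedBall_zero_iff] at hx
    rw [mem_ball_zero_iff]
    have h1 := norm_add_le (p - x) x
    rw [sub_add_cancel] at h1
    have h2 : M * ‖y - x‖ ≤ M * τ0 := by gcongr
    have h3 : M * τ0 = (δ - ρ') / 2 := by rw [hτ0]; field_simp
    linarith
  have hxδ : x ∈ ball (0 : X) δ := hsub (mem_closedBall_self (by positivity))
  have hRc : ContinuousOn R (ball (0 : X) δ) := by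
    have : LipschitzOnWith L.toNNReal R (ball (0 : X) δ) := by
      apply LipschitzOnWith.of_dist_le_mul
      intro p hp p' hp'
      rw [dist_eq_norm, dist_eq_norm, Real.coe_toNNReal _ hLpos.le]
      exact hL _ hp' _ hp
    exact this.continuousOn
  obtain ⟨q, hq, u, hu, A, hA, τ, hτ, hsup⟩ := fuzzy_mvt (fun p => ⟪z, R p⟫) x y (L - 2 * s) L
    (s / 3) (M * ‖y - x‖) (by linarith) hLpos.le (by positivity) hne le_rfl
    ((continuousOn_const.inner hRc).mono hsub) (by
      intro p hp
      rw [← inner_sub_right]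
      refine (abs_real_inner_le_norm _ _).trans ?_
      rw [hzn, one_mul]
      exact hL _ hxδ _ (hsub hp)) (by
      rw [← inner_sub_right, ← hw, hz, inner_smul_left, real_inner_self_eq_norm_sq]
      simp only [conj_trivial]
      have : 1 / ‖w‖ * ‖w‖ ^ 2 = ‖w‖ := by field_simp
      rw [this]
      have : L - 2 * s + 3 * (s / 3) = L - s := by ring
      rw [this]
      exact hgap.le)
  have hqδ : q ∈ ball (0 : X) δ := hsub (ball_subset_closedBall hq)
  have hsup' : ∀ x, ‖x - q‖ < τ → ⟪z, R x - R q⟫ ≤ ⟪u, x - q⟫ + A * ‖x - q‖ ^ 2 := by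
    intro p hp
    have := hsup p hp
    rw [inner_sub_right]
    linarith
  have hupos : 0 < ‖u‖ := by linarith
  have hqn : ‖q‖ < δ := mem_ball_zero_iff.1 hqδ
  set t := min (τ / 2) (min (s / (A + 1)) ((δ - ‖q‖) / 3)) with ht
  have htpos : 0 < t := by
    refine lt_min (by positivity) (lt_min (by positivity) ?_)
    linarith
  have ht1 : t ≤ τ / 2 := min_le_left _ _
  have ht2 : A * t ≤ s := by
    have : t ≤ s / (A + 1) := (min_le_right _ _).trans (min_le_left _ _)
    rw [le_div_iff₀ (by positivity)] at this
    nlinarith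
  have ht3 : t ≤ (δ - ‖q‖) / 3 := (min_le_right _ _).trans (min_le_right _ _)
  set v := -((1 / ‖u‖) • u) with hv
  have hvn : ‖v‖ = 1 := by
    rw [hv, norm_neg, norm_smul, Real.norm_of_nonneg (by positivity)]
    field_simp
  set q2 := q + t • v with hq2
  have hq2q : q2 - q = t • v := by rw [hq2]; abel
  have hq2n : ‖q2 - q‖ = t := by
    rw [hq2q, norm_smul, hvn, Real.norm_of_nonneg htpos.le, mul_one]
  have hnear : ∀ p, ‖p - q‖ ≤ 2 * t → p ∈ ball (0 : X) δ := by
    intro p hp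
    rw [mem_ball_zero_iff]
    have h1 := norm_add_le (p - q) q
    rw [sub_add_cancel] at h1
    linarith
  have hq2δ : q2 ∈ ball (0 : X) δ := hnear _ (by rw [hq2n]; linarith)
  have hdR := hL q hqδ q2 hq2δ
  rw [hq2n] at hdR
  have hsm : ‖(1 / L) • (R q2 - R q)‖ ≤ t := by
    rw [norm_smul, Real.norm_of_nonneg (by positivity), div_mul_eq_mul_div, div_le_iff₀ hLpos]
    linarith
  have hco := cocoercive R φ (ball 0 δ) (convex_ball _ _) L hLpos hφ hL q q2 hqδ hq2δ
    (hnear _ (by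
      have h1 := norm_sub_le (q2 - q) ((1 / L) • (R q2 - R q))
      have h2 : q2 - (1 / L) • (R q2 - R q) - q = q2 - q - (1 / L) • (R q2 - R q) := by abel
      rw [h2]
      linarith))
    (hnear _ (by rw [add_sub_cancel_left]; linarith))
  have hin := hsup' q2 (by rw [hq2n]; linarith)
  rw [hq2n, hq2q, inner_smul_right] at hin
  have huv : ⟪u, v⟫ = -‖u‖ := by
    rw [hv, inner_neg_right, inner_smul_right, real_inner_self_eq_norm_sq]
    field_simp
  rw [huv] at hin
  have hfin := hilb_ineq z u ((1 / t) • (R q2 - R q)) L s hLpos hzn hupos (by linarith)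
    (by
      rw [norm_smul, Real.norm_of_nonneg (by positivity), div_mul_eq_mul_div, div_le_iff₀ htpos]
      linarith)
    (by
      rw [inner_smul_right, div_mul_eq_mul_div, div_le_iff₀ htpos]
      nlinarith)
    (by
      rw [← hv, norm_smul, Real.norm_of_nonneg (by positivity), inner_smul_left]
      simp only [conj_trivial]
      rw [hq2q, inner_smul_right] at hco
      have e1 : (1 / t * ‖R q2 - R q‖) ^ 2 = ‖R q2 - R q‖ ^ 2 * (1 / t ^ 2) := by field_simp
      have e2 : L * (1 / t * ⟪R q2 - R q, v⟫) = L * (t * ⟪R q2 - R q, v⟫) * (1 / t ^ 2) := by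
        field_simp
      rw [e1, e2]
      exact mul_le_mul_of_nonneg_right hco (by positivity))
  exact ⟨q, hqδ, z, u, hzn, hu, hfin.1, hfin.2, A, hA, τ, hτ, hsup'⟩

lemma bootstrap [CompleteSpace X] (R : X → X) (φ : X → ℝ) (δ : ℝ)
    (hφ : ∀ q ∈ ball (0 : X) δ, ∀ q' ∈ ball (0 : X) δ, φ q + ⟪R q, q' - q⟫ ≤ φ q')
    (K : ℝ) (hK0 : 0 ≤ K)
    (hK : ∀ q ∈ ball (0 : X) δ, ∀ q' ∈ ball (0 : X) δ, ‖R q' - R q‖ ≤ K * ‖q' - q‖)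
    (κ σ r : ℝ) (hκ : 0 < κ) (hσ : 0 ≤ σ) (hrκ : r < κ⁻¹)
    (hsec : ∀ q ∈ ball (0 : X) δ, ∀ z u : X, ∀ A : ℝ, 0 ≤ A → ∀ τ : ℝ, 0 < τ →
      (∀ x, ‖x - q‖ < τ → ⟪z, R x - R q⟫ ≤ ⟪u, x - q⟫ + A * ‖x - q‖ ^ 2) →
      ‖u‖ ≤ κ * ‖z - σ • u‖ ∧ -r * ‖u‖ ^ 2 ≤ ⟪z - σ • u, u⟫) :
    ∀ q ∈ ball (0 : X) δ, ∀ q' ∈ ball (0 : X) δ, ‖R q' - R q‖ ≤ κ / (1 + κ * σ) * ‖q' - q‖ := by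
  set S : Set ℝ := {k | 0 ≤ k ∧ ∀ q ∈ ball (0 : X) δ, ∀ q' ∈ ball (0 : X) δ,
    ‖R q' - R q‖ ≤ k * ‖q' - q‖} with hS
  have hSne : S.Nonempty := ⟨K, hK0, hK⟩
  have hSb : BddBelow S := ⟨0, fun k hk => hk.1⟩
  set L := sInf S with hLdef
  have hL0 : 0 ≤ L := le_csInf hSne fun k hk => hk.1
  have hL : ∀ q ∈ ball (0 : X) δ, ∀ q' ∈ ball (0 : X) δ, ‖R q' - R q‖ ≤ L * ‖q' - q‖ := by
    intro q hq q' hq'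
    rcases eq_or_ne q' q with rfl | hne
    · simp
    have hpos : 0 < ‖q' - q‖ := norm_pos_iff.2 (sub_ne_zero.2 hne)
    rw [← div_le_iff₀ hpos]
    apply le_csInf hSne
    intro k hk
    rw [div_le_iff₀ hpos]
    exact hk.2 q hq q' hq'
  suffices hmain : L ≤ κ / (1 + κ * σ) by
    intro q hq q' hq'
    exact (hL q hq q' hq').trans (mul_le_mul_of_nonneg_right hmain (norm_nonneg _))
  rcases hL0.eq_or_lt with h0 | hLpos
  · rw [← h0]; positivity
  -- approximate extremal data
  have hstep : ∀ n : ℕ, ∃ M c : ℝ, L - 2 * (L / (n + 4)) ≤ M ∧ M ≤ L + L / (n + 4) ∧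
      (M - L / (n + 4)) ^ 2 / L - √(L ^ 2 - M ^ 2 + 2 * M * (L / (n + 4))) ≤ c ∧ c ≤ M ∧
      M ^ 2 ≤ κ ^ 2 * (1 - 2 * σ * c + σ ^ 2 * M ^ 2) ∧ -r * M ^ 2 ≤ c - σ * M ^ 2 := by
    intro n
    set s := L / ((n : ℝ) + 4) with hs
    have hspos : 0 < s := by positivity
    have hsL : 3 * s < L := by
      rw [hs, mul_div_assoc', div_lt_iff₀ (by positivity)]
      have : (0 : ℝ) ≤ n := by positivity
      nlinarith
    have hnot : L - s ∉ S := by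
      intro h
      have := csInf_le hSb h
      linarith
    obtain ⟨a, ha, b, hb, hab⟩ : ∃ a ∈ ball (0 : X) δ, ∃ b ∈ ball (0 : X) δ,
        (L - s) * ‖b - a‖ < ‖R b - R a‖ := by
      by_contra hcon
      push Not at hcon
      exact hnot ⟨by linarith, hcon⟩
    obtain ⟨q, hq, z, u, hz, hu1, hu2, hzu, A, hA, τ, hτ, hsup⟩ :=
      boot_step R φ δ hφ L s hspos hsL hL a b ha hb hab
    obtain ⟨c1, c2⟩ := hsec q hq z u A hA τ hτ hsup
    refine ⟨‖u‖, ⟪z, u⟫, hu1, hu2, hzu, ?_, ?_, ?_⟩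
    · have := real_inner_le_norm z u
      rwa [hz, one_mul] at this
    · have h1 : ‖u‖ ^ 2 ≤ (κ * ‖z - σ • u‖) ^ 2 := pow_le_pow_left₀ (norm_nonneg _) c1 2
      rw [mul_pow, norm_sub_sq_real, hz, inner_smul_right, norm_smul, mul_pow, Real.norm_eq_abs,
        sq_abs] at h1
      nlinarith
    · rw [inner_sub_left, inner_smul_left, real_inner_self_eq_norm_sq] at c2
      simpa using c2
  choose M c h1 h2 h3 h4 h5 h6 using hstep
  have hs0 : Tendsto (fun n : ℕ => L / ((n : ℝ) + 4)) atTop (𝓝 0) := by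
    have : Tendsto (fun n : ℕ => (n : ℝ) + 4) atTop atTop :=
      tendsto_atTop_add_const_right _ _ tendsto_natCast_atTop_atTop
    exact this.const_div_atTop L
  have hM : Tendsto M atTop (𝓝 L) := by
    refine tendsto_of_tendsto_of_tendsto_of_le_of_le (g := fun n : ℕ => L - 2 * (L / ((n : ℝ) + 4)))
      (h := fun n : ℕ => L + L / ((n : ℝ) + 4)) ?_ ?_ h1 h2
    · simpa using (hs0.const_mul 2).const_sub L
    · simpa using hs0.const_add L
  have hc : Tendsto c atTop (𝓝 L) := by
    refine tendsto_of_tendsto_of_tendsto_of_le_of_le ?_ hM h3 h4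
    have e1 : Tendsto (fun n : ℕ => (M n - L / ((n : ℝ) + 4)) ^ 2 / L) atTop
        (𝓝 ((L - 0) ^ 2 / L)) := ((hM.sub hs0).pow 2).div_const L
    have e2 : Tendsto (fun n : ℕ => √(L ^ 2 - M n ^ 2 + 2 * M n * (L / ((n : ℝ) + 4)))) atTop
        (𝓝 (√(L ^ 2 - L ^ 2 + 2 * L * 0))) :=
      (((hM.pow 2).const_sub (L ^ 2)).add ((hM.const_mul 2).mul hs0)).sqrt
    have e3 := e1.sub e2
    have e4 : (L - 0) ^ 2 / L - √(L ^ 2 - L ^ 2 + 2 * L * 0) = L := by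
      simp
      field_simp
    rwa [e4] at e3
  have i1 : L ^ 2 ≤ κ ^ 2 * (1 - 2 * σ * L + σ ^ 2 * L ^ 2) :=
    le_of_tendsto_of_tendsto' (hM.pow 2)
      ((((hc.const_mul (2 * σ)).const_sub 1).add ((hM.pow 2).const_mul (σ ^ 2))).const_mul (κ ^ 2))
      h5
  have i2 : -r * L ^ 2 ≤ L - σ * L ^ 2 :=
    le_of_tendsto_of_tendsto' ((hM.pow 2).const_mul (-r)) (hc.sub ((hM.pow 2).const_mul σ)) h6
  have i3 : -r * L ≤ 1 - σ * L := by
    have : (-r * L) * L ≤ (1 - σ * L) * L := by nlinarith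
    exact le_of_mul_le_mul_right this hLpos
  have i4 : -L < κ * (1 - σ * L) := by
    have h7 : r * κ < 1 := by
      rw [← inv_mul_cancel₀ hκ.ne']
      exact mul_lt_mul_of_pos_right hrκ hκ
    have : κ * (-r * L) ≤ κ * (1 - σ * L) := by gcongr
    nlinarith
  have i5 : L ≤ κ * (1 - σ * L) := by
    have : L ^ 2 ≤ (κ * (1 - σ * L)) ^ 2 := by nlinarith
    have h8 := sq_le_sq.1 this
    by_contra hcon
    push Not at hcon
    have h9 : |κ * (1 - σ * L)| < L := abs_lt.2 ⟨i4, hcon⟩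
    rw [abs_of_pos hLpos] at h8
    linarith
  rw [le_div_iff₀ (by positivity)]
  nlinarith

lemma prox_subgrad (f : X → EReal) (x p : X) (τ A : ℝ) (hτ : 0 < τ) (hA : 0 ≤ A) (hfx : f x ≠ ⊤)
    (h : ∀ y, ‖y - x‖ < τ → f x + ((⟪p, y - x⟫ - A * ‖y - x‖ ^ 2 : ℝ) : EReal) ≤ f y) :
    p ∈ FrechetSubdiff f x := by
  refine ⟨hfx, fun ε hε => ⟨min τ (ε / (A + 1)), by positivity, fun y hy => ?_⟩⟩
  refine le_trans ?_ (h y (hy.trans_le (min_le_left _ _)))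
  refine add_le_add le_rfl (EReal.coe_le_coe_iff.2 ?_)
  have h1 : ‖y - x‖ < ε / (A + 1) := hy.trans_le (min_le_right _ _)
  rw [lt_div_iff₀ (by positivity)] at h1
  nlinarith [norm_nonneg (y - x)]

lemma frechet_limiting (f : X → EReal) (x p : X) (h : p ∈ FrechetSubdiff f x) :
    p ∈ LimitingSubdiff f x :=
  ⟨fun _ => x, fun _ => p, fun _ => h, tendsto_const_nhds, tendsto_const_nhds,
    fun _ => tendsto_const_nhds⟩

/-- Localized prox-regularity inequality. -/
def PRLoc (f : X → EReal) (xb : X) (ρ ε : ℝ) : Prop :=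
  ∀ x ∈ closedBall xb ε, ∀ p ∈ LimitingSubdiff f x, ‖p‖ ≤ ε →
    ∃ fx : ℝ, f x = (fx : EReal) ∧ ∀ y ∈ closedBall xb ε,
      ((fx + ⟪p, y - x⟫ - ρ / 2 * ‖y - x‖ ^ 2 : ℝ) : EReal) ≤ f y

lemma setup_loc (f : X → EReal) (hbot : ∀ x, f x ≠ ⊥) (xb : X)
    (hpr : ProxRegularAt f xb 0) (hsc : SubdiffContAt f xb 0) (η : ℝ) (hη : 0 < η) :
    ∃ ρ : ℝ, 0 < ρ ∧ ∃ ε : ℝ, 0 < ε ∧ ε ≤ η ∧ PRLoc f xb ρ ε := by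
  obtain ⟨hfin, ρ, hρ, ε, hε, hpr⟩ := hpr
  obtain ⟨a, ha⟩ : ∃ a : ℝ, f xb = (a : EReal) :=
    ⟨(f xb).toReal, (EReal.coe_toReal hfin (hbot xb)).symm⟩
  have hnb : Set.Ioo ((a - ε : ℝ) : EReal) ((a + ε : ℝ) : EReal) ∈ 𝓝 (f xb) := by
    rw [ha]
    apply Ioo_mem_nhds
    · exact EReal.coe_lt_coe_iff.2 (by linarith)
    · exact EReal.coe_lt_coe_iff.2 (by linarith)
  have h1 := hsc hnb
  rw [mem_map, Metric.mem_nhdsWithin_iff] at h1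
  obtain ⟨ε2, hε2, h1⟩ := h1
  refine ⟨ρ, hρ, min ε (min (ε2 / 2) η), by positivity,
    (min_le_right _ _).trans (min_le_right _ _), ?_⟩
  intro x hx p hp hpn
  have hm1 : min ε (min (ε2 / 2) η) ≤ ε := min_le_left _ _
  have hm2 : min ε (min (ε2 / 2) η) ≤ ε2 / 2 := (min_le_right _ _).trans (min_le_left _ _)
  rw [mem_closedBall] at hx
  have hfx : f x ∈ Set.Ioo ((a - ε : ℝ) : EReal) ((a + ε : ℝ) : EReal) := by
    refine @h1 (x, p) ⟨?_, hp⟩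
    rw [mem_ball, Prod.dist_eq]
    refine max_lt (by simp only; linarith) ?_
    simp only [dist_zero_right]
    linarith
  have hne : f x ≠ ⊤ := ne_top_of_lt hfx.2
  obtain ⟨fx, hfxe⟩ : ∃ fx : ℝ, f x = (fx : EReal) :=
    ⟨(f x).toReal, (EReal.coe_toReal hne (hbot x)).symm⟩
  refine ⟨fx, hfxe, fun y hy => ?_⟩
  rw [hfxe] at hfx
  have hl := EReal.coe_lt_coe_iff.1 hfx.1
  have hu := EReal.coe_lt_coe_iff.1 hfx.2
  have h2 := hpr y (closedBall_subset_closedBall hm1 hy) x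
    (by rw [mem_closedBall]; linarith)
    (by rw [hfxe, ha, ← EReal.coe_add]; exact EReal.coe_le_coe_iff.2 (by linarith))
    (by rw [hfxe, ha, ← EReal.coe_add]; exact EReal.coe_le_coe_iff.2 (by linarith))
    p hp (by rw [mem_closedBall, dist_zero_right]; linarith)
  rw [hfxe, ← EReal.coe_add] at h2
  rwa [add_sub_assoc]

lemma mono_loc (f : X → EReal) (xb : X) (ρ ε : ℝ) (h : PRLoc f xb ρ ε) (x x' q q' : X)
    (hx : x ∈ closedBall xb ε) (hx' : x' ∈ closedBall xb ε)
    (hp : q - (ρ + 2) • (x - xb) ∈ LimitingSubdiff f x)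
    (hp' : q' - (ρ + 2) • (x' - xb) ∈ LimitingSubdiff f x')
    (hn : ‖q - (ρ + 2) • (x - xb)‖ ≤ ε) (hn' : ‖q' - (ρ + 2) • (x' - xb)‖ ≤ ε) :
    2 * ‖x' - x‖ ≤ ‖q' - q‖ := by
  obtain ⟨fx, e1, h1⟩ := h x hx _ hp hn
  obtain ⟨fx', e2, h2⟩ := h x' hx' _ hp' hn'
  have i1 := h1 x' hx'
  have i2 := h2 x hx
  rw [e2] at i1
  rw [e1] at i2
  have i1 := EReal.coe_le_coe_iff.1 i1
  have i2 := EReal.coe_le_coe_iff.1 i2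
  have e3 : x - x' = -(x' - x) := by abel
  rw [e3, inner_neg_right, norm_neg] at i2
  have e4 : q' - (ρ + 2) • (x' - xb) = (q - (ρ + 2) • (x - xb)) + ((q' - q)
      - (ρ + 2) • (x' - x)) := by
    rw [smul_sub, smul_sub, smul_sub]; abel
  have e5 : ⟪(q' - q) - (ρ + 2) • (x' - x), x' - x⟫ =
      ⟪q' - q, x' - x⟫ - (ρ + 2) * ‖x' - x‖ ^ 2 := by
    rw [inner_sub_left, inner_smul_left, real_inner_self_eq_norm_sq]; simp
  rw [e4, inner_add_left, e5] at i2
  have i3 : 2 * ‖x' - x‖ ^ 2 ≤ ‖q' - q‖ * ‖x' - x‖ := by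
    have := real_inner_le_norm (q' - q) (x' - x)
    nlinarith
  rcases (norm_nonneg (x' - x)).eq_or_lt with h0 | h0
  · rw [← h0]; simp
  · refine le_of_mul_le_mul_right ?_ h0
    nlinarith

lemma resolvent_approx [CompleteSpace X] (f : X → EReal) (hbot : ∀ x, f x ≠ ⊥)
    (hlsc : LowerSemicontinuous f) (xb : X) (h0 : (0 : X) ∈ LimitingSubdiff f xb) (ρ ε : ℝ)
    (hρ : 0 < ρ) (hε : 0 < ε) (hPR : PRLoc f xb ρ ε) (δ : ℝ) (hδ : 0 < δ) (hδ1 : δ ≤ 1 / 16)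
    (hδ2 : δ * (8 * (ρ + 3)) ≤ ε) (q : X) (hq : ‖q‖ < δ) (e : ℝ) (he : 0 < e) (heδ : e ≤ δ) :
    ∃ x q' : X, ‖q' - q‖ ≤ e ∧ ‖x - xb‖ ≤ ε / 2 ∧ ‖q' - (ρ + 2) • (x - xb)‖ ≤ ε / 2 ∧
      q' - (ρ + 2) • (x - xb) ∈ LimitingSubdiff f x := by
  obtain ⟨a, ha, hlow⟩ := hPR xb (mem_closedBall_self hε.le) 0 h0 (by simpa using hε.le)
  simp only [inner_zero_left, add_zero] at hlow
  set C : Set X := closedBall xb ε ∩ f ⁻¹' Set.Iic ((a + 1 : ℝ) : EReal) with hC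
  have hCc : IsClosed C := isClosed_closedBall.inter (hlsc.isClosed_preimage _)
  have hfinC : ∀ y ∈ C, f y = (((f y).toReal : ℝ) : EReal) := by
    intro y hy
    refine (EReal.coe_toReal ?_ (hbot y)).symm
    exact ne_top_of_le_ne_top (EReal.coe_ne_top _) hy.2
  have hxbC : xb ∈ C := ⟨mem_closedBall_self hε.le, by
    change f xb ≤ _
    rw [ha]; exact EReal.coe_le_coe_iff.2 (by linarith)⟩
  have hlowC : ∀ y ∈ C, a - ρ / 2 * ‖y - xb‖ ^ 2 ≤ (f y).toReal := by
    intro y hy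
    have := hlow y hy.1
    rw [hfinC y hy] at this
    exact EReal.coe_le_coe_iff.1 this
  have hrlsc : LowerSemicontinuousOn (fun y => (f y).toReal) C := by
    intro x hx t ht
    have h1 : (t : EReal) < f x := by rw [hfinC x hx]; exact EReal.coe_lt_coe_iff.2 ht
    have h2 : ∀ᶠ y in 𝓝[C] x, f y > (t : EReal) :=
      (hlsc x _ h1).filter_mono nhdsWithin_le_nhds
    filter_upwards [h2, self_mem_nhdsWithin] with y hy hyC
    have hy : (t : EReal) < f y := hy
    rw [hfinC y hyC] at hy
    exact EReal.coe_lt_coe_iff.1 hy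
  let g : X → ℝ := fun y => (f y).toReal + ((ρ + 2) / 2 * ‖y - xb‖ ^ 2 - ⟪q, y - xb⟫)
  have hglsc : LowerSemicontinuousOn g C := by
    have hc : Continuous fun y : X => (ρ + 2) / 2 * ‖y - xb‖ ^ 2 - ⟪q, y - xb⟫ := by fun_prop
    exact hrlsc.add (hc.lowerSemicontinuous.lowerSemicontinuousOn C)
  have hgl : ∀ y ∈ C, a + ‖y - xb‖ ^ 2 - ‖q‖ * ‖y - xb‖ ≤ g y := by
    intro y hy
    have h1 := hlowC y hy
    have h2 := real_inner_le_norm q (y - xb)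
    simp only [g]
    nlinarith
  have hgxb : g xb = a := by simp [g, ha]
  obtain ⟨x, hxC, v, hv, hx⟩ := smooth_vp C hCc (2 * ε) (by
      intro x hx y hy
      rw [← dist_eq_norm]
      have := dist_triangle_right x y xb
      have h1 := mem_closedBall.1 hx.1
      have h2 := mem_closedBall.1 hy.1
      linarith) xb hxbC g hglsc (a - 1) (by
      intro y hy
      have h1 := hgl y hy
      have := norm_nonneg q
      nlinarith [sq_nonneg (‖y - xb‖ - ‖q‖ / 2)]) e he
  set s := ‖x - xb‖ with hs
  have hs0 : 0 ≤ s := norm_nonneg _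
  have hxb := hx xb hxbC
  rw [hgxb, ← neg_sub x xb, inner_neg_right, norm_neg, ← hs] at hxb
  have hvs : -⟪v, x - xb⟫ ≤ e * s := by
    have h1 := (abs_le.1 (abs_real_inner_le_norm v (x - xb))).1
    have h2 : ‖v‖ * ‖x - xb‖ ≤ e * s := mul_le_mul_of_nonneg_right hv hs0
    linarith
  have hgx := hgl x hxC
  rw [← hs] at hgx
  have hs1 : s ≤ 4 * δ := by
    by_contra hcon
    push Not at hcon
    have h1 : s ^ 2 ≤ (‖q‖ + e) * s + e * s ^ 2 := by nlinarith
    have h2 : s * s ≤ ((‖q‖ + e) + e * s) * s := by nlinarith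
    have h3 : s ≤ (‖q‖ + e) + e * s := le_of_mul_le_mul_right h2 (by linarith)
    nlinarith
  have hsε : s ≤ ε / 2 := by nlinarith
  have hfx : (f x).toReal ≤ a + 1 / 2 := by
    have h1 : g x = (f x).toReal + ((ρ + 2) / 2 * s ^ 2 - ⟪q, x - xb⟫) := rfl
    have h2 : ⟪q, x - xb⟫ ≤ δ * s :=
      (real_inner_le_norm _ _).trans (mul_le_mul_of_nonneg_right hq.le hs0)
    have h3 : 0 ≤ (ρ + 2) / 2 * s ^ 2 := by positivity
    have h4 : s ≤ 1 / 4 := by linarith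
    have h5 : δ * s ≤ 1 / 16 * (1 / 4) := mul_le_mul hδ1 h4 hs0 (by norm_num)
    have h6 : e * s ≤ 1 / 16 * (1 / 4) := mul_le_mul (by linarith) h4 hs0 (by norm_num)
    have h7 : e * s ^ 2 ≤ 1 / 16 * (1 / 4) ^ 2 :=
      mul_le_mul (by linarith) (pow_le_pow_left₀ hs0 h4 2) (by positivity) (by norm_num)
    linarith
  set p := (q - v) - (ρ + 2) • (x - xb) with hp
  refine ⟨x, q - v, by rw [sub_sub_cancel_left, norm_neg]; exact hv, hsε, ?_, ?_⟩
  · have h1 := norm_sub_le (q - v) ((ρ + 2) • (x - xb))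
    have h2 := norm_sub_le q v
    rw [norm_smul, Real.norm_of_nonneg (by positivity), ← hs] at h1
    rw [← hp] at h1 ⊢
    nlinarith
  · apply frechet_limiting
    have hτ : 0 < min (ε / 2) (1 / (2 * (‖p‖ + 1))) := by positivity
    refine prox_subgrad f x p _ ((ρ + 2) / 2 + e) hτ (by positivity)
      (by rw [hfinC x hxC]; exact EReal.coe_ne_top _) ?_
    intro y hy
    have hy1 : ‖y - x‖ < ε / 2 := hy.trans_le (min_le_left _ _)
    have hy2 : ‖y - x‖ < 1 / (2 * (‖p‖ + 1)) := hy.trans_le (min_le_right _ _)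
    rw [lt_div_iff₀ (by positivity)] at hy2
    rw [hfinC x hxC, ← EReal.coe_add]
    by_cases hyC : y ∈ C
    · rw [hfinC y hyC]
      apply EReal.coe_le_coe_iff.2
      have h1 := hx y hyC
      have e1 : ‖y - xb‖ ^ 2 = ‖y - x‖ ^ 2 + 2 * ⟪x - xb, y - x⟫ + s ^ 2 := by
        have h : y - xb = (x - xb) + (y - x) := by abel
        rw [h, norm_add_sq_real]; ring
      have e2 : ⟪q, y - xb⟫ = ⟪q, y - x⟫ + ⟪q, x - xb⟫ := by
        rw [← inner_add_right, sub_add_sub_cancel]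
      have e3 : ⟪p, y - x⟫ = ⟪q, y - x⟫ - ⟪v, y - x⟫ - (ρ + 2) * ⟪x - xb, y - x⟫ := by
        rw [hp, inner_sub_left, inner_sub_left, inner_smul_left]; simp
      simp only [g] at h1
      rw [e1, e2, ← hs] at h1
      rw [e3]
      nlinarith
    · have hyb : y ∈ closedBall xb ε := by
        rw [mem_closedBall, dist_eq_norm]
        have := norm_add_le (y - x) (x - xb)
        rw [sub_add_sub_cancel] at this
        linarith
      have hgt : ((a + 1 : ℝ) : EReal) < f y := by
        by_contra hcon
        exact hyC ⟨hyb, not_lt.1 hcon⟩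
      refine le_trans (EReal.coe_le_coe_iff.2 ?_) hgt.le
      have h1 := real_inner_le_norm p (y - x)
      have h2 : 0 ≤ ((ρ + 2) / 2 + e) * ‖y - x‖ ^ 2 := by positivity
      nlinarith [norm_nonneg (y - x), norm_nonneg p]

lemma resolvent_exists [CompleteSpace X] (f : X → EReal) (hbot : ∀ x, f x ≠ ⊥)
    (hlsc : LowerSemicontinuous f) (xb : X) (h0 : (0 : X) ∈ LimitingSubdiff f xb) (ρ ε : ℝ)
    (hρ : 0 < ρ) (hε : 0 < ε) (hPR : PRLoc f xb ρ ε) (δ : ℝ) (hδ : 0 < δ) (hδ1 : δ ≤ 1 / 16)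
    (hδ2 : δ * (8 * (ρ + 3)) ≤ ε) (q : X) (hq : ‖q‖ < δ) :
    ∃ x : X, ‖x - xb‖ ≤ ε / 2 ∧ ‖q - (ρ + 2) • (x - xb)‖ ≤ ε / 2 ∧
      q - (ρ + 2) • (x - xb) ∈ LimitingSubdiff f x := by
  have happ : ∀ n : ℕ, ∃ x q' : X, ‖q' - q‖ ≤ δ * (1 / ((n : ℝ) + 1)) ∧ ‖x - xb‖ ≤ ε / 2 ∧
      ‖q' - (ρ + 2) • (x - xb)‖ ≤ ε / 2 ∧ q' - (ρ + 2) • (x - xb) ∈ LimitingSubdiff f x := by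
    intro n
    refine resolvent_approx f hbot hlsc xb h0 ρ ε hρ hε hPR δ hδ hδ1 hδ2 q hq _ (by positivity) ?_
    have : 1 / ((n : ℝ) + 1) ≤ 1 := by
      rw [div_le_one (by positivity)]
      have : (0 : ℝ) ≤ n := by positivity
      linarith
    nlinarith
  choose xs qs h1 h2 h3 h4 using happ
  have hq' : Tendsto qs atTop (𝓝 q) := by
    rw [tendsto_iff_norm_sub_tendsto_zero]
    refine squeeze_zero (fun n => norm_nonneg _) h1 ?_
    simpa using tendsto_one_div_add_atTop_nhds_zero_nat.const_mul δ
  have hxB : ∀ n, xs n ∈ closedBall xb ε := fun n => by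
    rw [mem_closedBall, dist_eq_norm]
    have := h2 n
    linarith
  have hcau : CauchySeq xs := by
    rw [Metric.cauchySeq_iff]
    intro e he
    obtain ⟨N, hN⟩ := Metric.cauchySeq_iff.1 hq'.cauchySeq e he
    refine ⟨N, fun m hm n hn => ?_⟩
    have := mono_loc f xb ρ ε hPR (xs n) (xs m) (qs n) (qs m) (hxB n) (hxB m) (h4 n) (h4 m)
      (by have := h3 n; linarith) (by have := h3 m; linarith)
    have h5 := hN m hm n hn
    rw [dist_eq_norm] at h5 ⊢
    linarith [norm_nonneg (xs m - xs n)]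
  obtain ⟨x, hx⟩ := cauchySeq_tendsto_of_complete hcau
  have hps : Tendsto (fun n => qs n - (ρ + 2) • (xs n - xb)) atTop
      (𝓝 (q - (ρ + 2) • (x - xb))) := hq'.sub ((hx.sub_const xb).const_smul (ρ + 2))
  set p := q - (ρ + 2) • (x - xb) with hp
  have hxn : ‖x - xb‖ ≤ ε / 2 := le_of_tendsto' (hx.sub_const xb).norm h2
  have hpn : ‖p‖ ≤ ε / 2 := le_of_tendsto' hps.norm h3
  refine ⟨x, hxn, hpn, ?_⟩
  have hineq : ∀ y ∈ closedBall xb ε, ∀ Y : ℝ, f y = (Y : EReal) →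
      f x ≤ ((Y - (⟪p, y - x⟫ - ρ / 2 * ‖y - x‖ ^ 2) : ℝ) : EReal) := by
    intro y hy Y hY
    by_contra hcon
    push Not at hcon
    obtain ⟨t, ht1, ht2⟩ := EReal.lt_iff_exists_real_btwn.1 hcon
    have ht1 := EReal.coe_lt_coe_iff.1 ht1
    have hl := hx.eventually (hlsc x _ ht2)
    have hlim : Tendsto (fun n => Y - (⟪qs n - (ρ + 2) • (xs n - xb), y - xs n⟫
        - ρ / 2 * ‖y - xs n‖ ^ 2)) atTop (𝓝 (Y - (⟪p, y - x⟫ - ρ / 2 * ‖y - x‖ ^ 2))) :=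
      ((hps.inner (hx.const_sub y)).sub (((hx.const_sub y).norm.pow 2).const_mul (ρ / 2))).const_sub Y
    obtain ⟨n, hn1, hn2⟩ := (hl.and (hlim.eventually (gt_mem_nhds ht1))).exists
    obtain ⟨fx, hfx, hfy⟩ := hPR (xs n) (hxB n) _ (h4 n) (by have := h3 n; linarith)
    have h5 := hfy y hy
    rw [hY] at h5
    have h5 := EReal.coe_le_coe_iff.1 h5
    rw [hfx] at hn1
    have h6 := EReal.coe_lt_coe_iff.1 hn1
    linarith
  obtain ⟨a, ha, -⟩ := hPR xb (mem_closedBall_self hε.le) 0 h0 (by simpa using hε.le)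
  have hfin : f x ≠ ⊤ := ne_top_of_le_ne_top (EReal.coe_ne_top _)
    (hineq xb (mem_closedBall_self hε.le) a ha)
  have hfx : f x = ((f x).toReal : EReal) := (EReal.coe_toReal hfin (hbot x)).symm
  apply frechet_limiting
  refine prox_subgrad f x p (ε / 2) (ρ / 2) (by positivity) (by positivity) hfin ?_
  intro y hy
  have hyb : y ∈ closedBall xb ε := by
    rw [mem_closedBall, dist_eq_norm]
    have := norm_add_le (y - x) (x - xb)
    rw [sub_add_sub_cancel] at this
    linarith
  by_cases hty : f y = ⊤
  · rw [hty]; exact le_top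
  · have hfy : f y = ((f y).toReal : EReal) := (EReal.coe_toReal hty (hbot y)).symm
    have h5 := hineq y hyb _ hfy
    rw [hfx] at h5
    have h5 := EReal.coe_le_coe_iff.1 h5
    rw [hfx, hfy, ← EReal.coe_add]
    exact EReal.coe_le_coe_iff.2 (by linarith)

lemma fixed_pt [CompleteSpace X] (R : X → X) (δ σ c γ : ℝ) (hσ : 0 < σ) (hc : 0 < c) (hγ : 0 < γ)
    (hR0 : R 0 = 0) (hδ : γ * (σ + c) ≤ δ)
    (hLip : ∀ q ∈ ball (0 : X) δ, ∀ q' ∈ ball (0 : X) δ, (σ + c) * ‖R q' - R q‖ ≤ ‖q' - q‖)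
    (p : X) (hp : ‖p‖ < γ * c) : ∃ y : X, ‖y‖ ≤ γ ∧ R (p + σ • y) = y := by
  have hq : ∀ y : X, ‖y‖ ≤ γ → ‖p + σ • y‖ < γ * (σ + c) := by
    intro y hy
    have h1 := norm_add_le p (σ • y)
    rw [norm_smul, Real.norm_of_nonneg hσ.le] at h1
    have : σ * ‖y‖ ≤ σ * γ := by gcongr
    nlinarith
  have hq' : ∀ y : X, ‖y‖ ≤ γ → p + σ • y ∈ ball (0 : X) δ := by
    intro y hy
    rw [mem_ball_zero_iff]
    exact (hq y hy).trans_le hδ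
  have h0 : (0 : X) ∈ ball (0 : X) δ := by
    rw [mem_ball_zero_iff, norm_zero]; exact lt_of_lt_of_le (by positivity) hδ
  have hmaps : Set.MapsTo (fun y => R (p + σ • y)) (closedBall (0 : X) γ) (closedBall (0 : X) γ) := by
    intro y hy
    rw [mem_closedBall_zero_iff] at hy ⊢
    have h1 := hLip 0 h0 _ (hq' y hy)
    rw [hR0, sub_zero, sub_zero] at h1
    have h2 := hq y hy
    have h3 : (σ + c) * ‖R (p + σ • y)‖ ≤ (σ + c) * γ := by linarith
    exact le_of_mul_le_mul_left h3 (by positivity)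
  have hK : σ / (σ + c) < 1 := by rw [div_lt_one (by positivity)]; linarith
  have hcontr : ContractingWith (Real.toNNReal (σ / (σ + c)))
      (hmaps.restrict (fun y => R (p + σ • y)) (closedBall (0 : X) γ) (closedBall (0 : X) γ)) := by
    refine ⟨?_, ?_⟩
    · rw [← NNReal.coe_lt_coe, Real.coe_toNNReal _ (by positivity)]; simpa using hK
    · apply LipschitzWith.of_dist_le_mul
      rintro ⟨x, hx⟩ ⟨y, hy⟩
      rw [Real.coe_toNNReal _ (by positivity)]
      rw [mem_closedBall_zero_iff] at hx hy
      simp only [Subtype.dist_eq, Set.MapsTo.val_restrict_apply, dist_eq_norm]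
      have h1 := hLip _ (hq' y hy) _ (hq' x hx)
      rw [add_sub_add_left_eq_sub, ← smul_sub, norm_smul, Real.norm_of_nonneg hσ.le] at h1
      rw [div_mul_eq_mul_div, le_div_iff₀ (by positivity)]
      linarith
  obtain ⟨y, hy, hfix, _⟩ := hcontr.exists_fixedPoint' (isClosed_closedBall.isComplete) hmaps
    (x := (0 : X)) (by simp [hγ.le]) (edist_ne_top _ _)
  exact ⟨y, by simpa using hy, hfix⟩

lemma tilt_of_growth [CompleteSpace X] (f : X → EReal) (xb : X)
    (R : X → X) (ε δ σ κ : ℝ) (hε : 0 < ε) (hδ : 0 < δ) (hσ : 0 < σ) (hκ : 0 < κ)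
    (hR0 : R 0 = 0)
    (hLip : ∀ q ∈ ball (0 : X) δ, ∀ q' ∈ ball (0 : X) δ, (σ + κ⁻¹) * ‖R q' - R q‖ ≤ ‖q' - q‖)
    (hgrow : ∀ q ∈ ball (0 : X) δ, ∀ y ∈ closedBall xb ε,
      q + (σ + κ⁻¹) • (y - (xb + R q)) ∈ ball (0 : X) δ → ∃ fx : ℝ, f (xb + R q) = (fx : EReal) ∧
      ((fx + ⟪q - σ • R q, y - (xb + R q)⟫ + κ⁻¹ / 2 * ‖y - (xb + R q)‖ ^ 2 : ℝ) : EReal) ≤ f y) :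
    TiltStableWith f xb κ := by
  have hc : 0 < κ⁻¹ := inv_pos.2 hκ
  set c := κ⁻¹ with hcdef
  obtain ⟨γ, hγ, hγε, hγδ⟩ : ∃ γ : ℝ, 0 < γ ∧ γ ≤ ε ∧ 4 * (γ * (σ + c)) ≤ δ := by
    refine ⟨min ε (δ / (4 * (σ + c))), lt_min hε (by positivity), min_le_left _ _, ?_⟩
    have := min_le_right ε (δ / (4 * (σ + c)))
    rw [le_div_iff₀ (by positivity)] at this
    linarith
  have hs : 0 < γ * (σ + c) := by positivity
  have hex : ∀ p : X, ∃ y : X, ‖p‖ < γ * c → ‖y‖ ≤ γ ∧ R (p + σ • y) = y := by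
    intro p
    by_cases hp : ‖p‖ < γ * c
    · obtain ⟨y, hy⟩ := fixed_pt R δ σ c γ hσ hc hγ hR0 (by linarith) hLip p hp
      exact ⟨y, fun _ => hy⟩
    · exact ⟨0, fun h => absurd h hp⟩
  choose Y hY using hex
  have hstrong : ∀ p : X, ‖p‖ < γ * c → ∀ y ∈ closedBall xb γ, ∃ fx : ℝ,
      f (xb + Y p) = (fx : EReal) ∧
      ((fx + ⟪p, y - (xb + Y p)⟫ + c / 2 * ‖y - (xb + Y p)‖ ^ 2 : ℝ) : EReal) ≤ f y := by
    intro p hp y hy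
    obtain ⟨hy1, hy2⟩ := hY p hp
    have hq : ‖p + σ • Y p‖ < γ * (σ + c) := by
      have h1 := norm_add_le p (σ • Y p)
      rw [norm_smul, Real.norm_of_nonneg hσ.le] at h1
      have : σ * ‖Y p‖ ≤ σ * γ := by gcongr
      nlinarith
    have hd : ‖y - (xb + Y p)‖ ≤ 2 * γ := by
      rw [mem_closedBall, dist_eq_norm] at hy
      have : y - (xb + Y p) = (y - xb) - Y p := by abel
      rw [this]
      have := norm_sub_le (y - xb) (Y p)
      linarith
    have := hgrow (p + σ • Y p) (by rw [mem_ball_zero_iff]; linarith) y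
      (closedBall_subset_closedBall hγε hy) (by
        rw [mem_ball_zero_iff, hy2]
        have h1 := norm_add_le (p + σ • Y p) ((σ + c) • (y - (xb + Y p)))
        rw [norm_smul, Real.norm_of_nonneg (by positivity : (0 : ℝ) ≤ σ + c)] at h1
        have : (σ + c) * ‖y - (xb + Y p)‖ ≤ (σ + c) * (2 * γ) := by gcongr
        linarith)
    rw [hy2, add_sub_cancel_right] at this
    exact this
  have hmem : ∀ p : X, ‖p‖ < γ * c → xb + Y p ∈ closedBall xb γ := by
    intro p hp
    rw [mem_closedBall, dist_eq_norm, add_sub_cancel_left]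
    exact (hY p hp).1
  refine ⟨γ, hγ, ball 0 (γ * c), ball_mem_nhds _ (by positivity), fun p => xb + Y p, ?_, ?_, ?_⟩
  · intro p hp
    rw [mem_ball_zero_iff] at hp
    ext x
    simp only [Set.mem_singleton_iff]
    constructor
    · rintro ⟨hx, hmin⟩
      obtain ⟨fx, e, h⟩ := hstrong p hp x hx
      have h2 := hmin _ (hmem p hp)
      rw [e] at h2
      induction hfx : f x with
      | bot => rw [hfx] at h; exact absurd (le_bot_iff.1 h) (EReal.coe_ne_bot _)
      | top =>
        rw [hfx, EReal.top_sub_coe, top_le_iff] at h2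
        exact absurd h2 (by rw [← EReal.coe_sub]; exact EReal.coe_ne_top _)
      | coe a =>
        rw [hfx] at h h2
        rw [EReal.coe_le_coe_iff] at h
        rw [← EReal.coe_sub, ← EReal.coe_sub, EReal.coe_le_coe_iff] at h2
        rw [inner_sub_right] at h
        have h3 : ‖x - (xb + Y p)‖ ^ 2 ≤ 0 := by
          have : c / 2 * ‖x - (xb + Y p)‖ ^ 2 ≤ c / 2 * 0 := by linarith
          exact le_of_mul_le_mul_left this (by positivity)
        have h4 : ‖x - (xb + Y p)‖ = 0 := by
          have := sq_nonneg ‖x - (xb + Y p)‖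
          exact pow_eq_zero_iff (two_ne_zero) |>.1 (le_antisymm h3 this)
        exact sub_eq_zero.1 (norm_eq_zero.1 h4)
    · rintro rfl
      refine ⟨hmem p hp, fun y hy => ?_⟩
      obtain ⟨fx, e, h⟩ := hstrong p hp y hy
      rw [e]
      induction hfy : f y with
      | bot => rw [hfy] at h; exact absurd (le_bot_iff.1 h) (EReal.coe_ne_bot _)
      | top => rw [EReal.top_sub_coe]; exact le_top
      | coe a =>
        rw [hfy] at h
        rw [EReal.coe_le_coe_iff] at h
        rw [← EReal.coe_sub, ← EReal.coe_sub, EReal.coe_le_coe_iff]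
        rw [inner_sub_right] at h
        have : 0 ≤ c / 2 * ‖y - (xb + Y p)‖ ^ 2 := by positivity
        linarith
  · apply LipschitzOnWith.of_dist_le_mul
    intro p hp p' hp'
    rw [mem_ball_zero_iff] at hp hp'
    rw [Real.coe_toNNReal _ hκ.le, dist_eq_norm, dist_eq_norm]
    obtain ⟨a, e1, h1⟩ := hstrong p hp _ (hmem p' hp')
    obtain ⟨b, e2, h2⟩ := hstrong p' hp' _ (hmem p hp)
    rw [e2, EReal.coe_le_coe_iff] at h1
    rw [e1, EReal.coe_le_coe_iff] at h2
    set m := xb + Y p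
    set m' := xb + Y p'
    have h3 : ⟪p' , m - m'⟫ = - ⟪p', m' - m⟫ := by rw [← inner_neg_right, neg_sub]
    rw [norm_sub_rev m' m] at h1
    have h4 : c * ‖m - m'‖ ^ 2 ≤ ⟪p - p', m - m'⟫ := by
      have h5 : ⟪p , m' - m⟫ = - ⟪p, m - m'⟫ := by rw [← inner_neg_right, neg_sub]
      rw [inner_sub_left]; linarith
    have h6 := real_inner_le_norm (p - p') (m - m')
    have h7 : c * ‖m - m'‖ ≤ ‖p - p'‖ := by
      by_cases hz : ‖m - m'‖ = 0
      · rw [hz]; simp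
      · have : 0 < ‖m - m'‖ := lt_of_le_of_ne (norm_nonneg _) (Ne.symm hz)
        refine le_of_mul_le_mul_right ?_ this
        nlinarith
    calc ‖m - m'‖ = κ * (c * ‖m - m'‖) := by rw [hcdef]; field_simp
      _ ≤ κ * ‖p - p'‖ := by gcongr
  · have h0 : ‖(0 : X)‖ < γ * c := by rw [norm_zero]; positivity
    obtain ⟨hy1, hy2⟩ := hY 0 h0
    have h1 := hLip 0 (by simp [hδ]) (0 + σ • Y 0) (by
      rw [mem_ball_zero_iff, zero_add, norm_smul, Real.norm_of_nonneg hσ.le]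
      have : σ * ‖Y 0‖ ≤ σ * γ := by gcongr
      nlinarith)
    rw [hy2, hR0, sub_zero, sub_zero, zero_add, norm_smul, Real.norm_of_nonneg hσ.le] at h1
    have h2 : ‖Y 0‖ = 0 := by
      have h3 : c * ‖Y 0‖ ≤ c * 0 := by linarith
      exact le_antisymm (le_of_mul_le_mul_left h3 hc) (norm_nonneg _)
    show xb + Y 0 = xb
    rw [norm_eq_zero.1 h2, add_zero]

lemma growth_of_lip (f : X → EReal) (xb : X)
    (R : X → X) (φ : X → ℝ) (ε δ σ κ : ℝ) (hσ : 0 < σ) (hκ : 0 < κ)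
    (hF : ∀ q ∈ ball (0 : X) δ,
      f (xb + R q) = ((⟪q, R q⟫ - φ q - σ / 2 * ‖R q‖ ^ 2 : ℝ) : EReal))
    (hB : ∀ q ∈ ball (0 : X) δ, ∀ y ∈ closedBall xb ε,
      ((⟪q, y - xb⟫ - φ q - σ / 2 * ‖y - xb‖ ^ 2 : ℝ) : EReal) ≤ f y)
    (hD : ∀ q ∈ ball (0 : X) δ, ∀ q' ∈ ball (0 : X) δ,
      φ q' ≤ φ q + ⟪R q, q' - q⟫ + (κ / (1 + κ * σ)) / 2 * ‖q' - q‖ ^ 2) :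
    ∀ q ∈ ball (0 : X) δ, ∀ y ∈ closedBall xb ε,
      q + (σ + κ⁻¹) • (y - (xb + R q)) ∈ ball (0 : X) δ → ∃ fx : ℝ, f (xb + R q) = (fx : EReal) ∧
      ((fx + ⟪q - σ • R q, y - (xb + R q)⟫ + κ⁻¹ / 2 * ‖y - (xb + R q)‖ ^ 2 : ℝ) : EReal) ≤ f y := by
  intro q hq y hy hq'
  refine ⟨_, hF q hq, le_trans ?_ (hB _ hq' y hy)⟩
  rw [EReal.coe_le_coe_iff]
  have h1 := hD q hq _ hq'
  obtain ⟨w, hw⟩ : ∃ w, w = y - (xb + R q) := ⟨_, rfl⟩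
  have hyw : y - xb = R q + w := by rw [hw]; abel
  rw [← hw] at h1 ⊢
  have hs : 0 < σ + κ⁻¹ := by positivity
  rw [add_sub_cancel_left, norm_smul, Real.norm_of_nonneg hs.le] at h1
  have h2 : (κ / (1 + κ * σ)) / 2 * ((σ + κ⁻¹) * ‖w‖) ^ 2 = (σ + κ⁻¹) / 2 * ‖w‖ ^ 2 := by
    have : 1 + κ * σ ≠ 0 := by positivity
    field_simp
    ring
  rw [h2, inner_smul_right] at h1
  rw [hyw, norm_add_sq_real]
  simp only [inner_add_right, inner_add_left, inner_sub_left, inner_smul_left, conj_trivial,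
    real_inner_self_eq_norm_sq]
  have h3 : ⟪w, R q⟫ = ⟪R q, w⟫ := real_inner_comm _ _
  rw [h3]
  nlinarith

theorem hsec_of (f : X → EReal) (xb : X) (R : X → X) (ε δ σ κ η r : ℝ) (hε : 0 < ε)
    (hδ : 0 < δ) (hσ : 0 < σ) (hη : ε ≤ η)
    (hR : ∀ q ∈ ball (0 : X) δ, ‖R q‖ ≤ ε / 2 ∧ ‖q - σ • R q‖ ≤ ε / 2 ∧
      q - σ • R q ∈ LimitingSubdiff f (xb + R q))
    (hid : ∀ x p : X, p ∈ LimitingSubdiff f x → ‖x - xb‖ ≤ ε → ‖p‖ ≤ ε →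
      p + σ • (x - xb) ∈ ball (0 : X) δ → x = xb + R (p + σ • (x - xb)))
    (hcond : ∀ x p : X, p ∈ LimitingSubdiff f x →
      (x, p) ∈ Metric.closedBall (xb, (0 : X)) η →
      ∀ u w : X, w ∈ CombinedSecondSubdiff f x p u →
        ‖u‖ ≤ κ * ‖w‖ ∧ -r * ‖u‖ ^ 2 ≤ ⟪w, u⟫) :
    ∀ q ∈ ball (0 : X) δ, ∀ z u : X, ∀ A : ℝ, 0 ≤ A → ∀ τ : ℝ, 0 < τ →
      (∀ x, ‖x - q‖ < τ → ⟪z, R x - R q⟫ ≤ ⟪u, x - q⟫ + A * ‖x - q‖ ^ 2) →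
      ‖u‖ ≤ κ * ‖z - σ • u‖ ∧ -r * ‖u‖ ^ 2 ≤ ⟪z - σ • u, u⟫ := by
  intro q hq z u A hA τ hτ hx
  obtain ⟨hR1, hR2, hR3⟩ := hR q hq
  refine hcond (xb + R q) (q - σ • R q) hR3 ?_ u (z - σ • u) ?_
  · rw [mem_closedBall, Prod.dist_eq, dist_eq_norm, dist_eq_norm, sub_zero, add_sub_cancel_left]
    exact max_le (by linarith) (by linarith)
  · intro e he
    rw [mem_ball_zero_iff] at hq
    have hq2 : 0 < δ - ‖q‖ := by linarith
    obtain ⟨d, hd, d1, d2, d3, d4⟩ : ∃ d : ℝ, 0 < d ∧ (1 + σ) * d ≤ τ ∧ (1 + σ) * d ≤ δ - ‖q‖ ∧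
        d ≤ ε / 2 ∧ A * (1 + σ) ^ 2 * d ≤ e := by
      refine ⟨min (τ / (1 + σ)) (min ((δ - ‖q‖) / (1 + σ)) (min (ε / 2)
        (e / ((A + 1) * (1 + σ) ^ 2)))), ?_, ?_, ?_, ?_, ?_⟩
      · refine lt_min (by positivity) (lt_min (by positivity) (lt_min (by positivity) (by positivity)))
      · rw [mul_comm, ← le_div_iff₀ (by positivity)]; exact min_le_left _ _
      · rw [mul_comm, ← le_div_iff₀ (by positivity)]
        exact (min_le_right _ _).trans (min_le_left _ _)
      · exact (min_le_right _ _).trans ((min_le_right _ _).trans (min_le_left _ _))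
      · have h : min (τ / (1 + σ)) (min ((δ - ‖q‖) / (1 + σ)) (min (ε / 2)
          (e / ((A + 1) * (1 + σ) ^ 2)))) ≤ e / ((A + 1) * (1 + σ) ^ 2) :=
          (min_le_right _ _).trans ((min_le_right _ _).trans (min_le_right _ _))
        have h0 : A * (1 + σ) ^ 2 ≤ (A + 1) * (1 + σ) ^ 2 := by gcongr; linarith
        calc _ ≤ A * (1 + σ) ^ 2 * (e / ((A + 1) * (1 + σ) ^ 2)) := by gcongr
          _ ≤ (A + 1) * (1 + σ) ^ 2 * (e / ((A + 1) * (1 + σ) ^ 2)) := by gcongr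
          _ = e := by field_simp
    refine ⟨d, hd, ?_⟩
    rintro ⟨x', p'⟩ hmem hdist
    replace hmem : p' ∈ LimitingSubdiff f x' := hmem
    set D := dist (x', p') (xb + R q, q - σ • R q) with hDdef
    have hD0 : 0 ≤ D := dist_nonneg
    have hDx : ‖x' - (xb + R q)‖ ≤ D := by
      rw [hDdef, Prod.dist_eq, ← dist_eq_norm]; exact le_max_left _ _
    have hDp : ‖p' - (q - σ • R q)‖ ≤ D := by
      rw [hDdef, Prod.dist_eq, ← dist_eq_norm]; exact le_max_right _ _
    obtain ⟨q', hq'⟩ : ∃ q', q' = p' + σ • (x' - xb) := ⟨_, rfl⟩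
    have hqq : q' - q = (p' - (q - σ • R q)) + σ • (x' - (xb + R q)) := by
      rw [hq']; module
    have hqn : ‖q' - q‖ ≤ (1 + σ) * D := by
      rw [hqq]
      refine (norm_add_le _ _).trans ?_
      rw [norm_smul, Real.norm_of_nonneg hσ.le]
      have : σ * ‖x' - (xb + R q)‖ ≤ σ * D := by gcongr
      linarith
    have hqd : (1 + σ) * D < (1 + σ) * d := by gcongr
    have hx' : x' = xb + R q' := by
      rw [hq']
      refine hid x' p' hmem ?_ ?_ ?_
      · have : x' - xb = (x' - (xb + R q)) + R q := by abel
        rw [this]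
        exact (norm_add_le _ _).trans (by linarith)
      · have : p' = (p' - (q - σ • R q)) + (q - σ • R q) := by abel
        rw [this]
        exact (norm_add_le _ _).trans (by linarith)
      · rw [← hq', mem_ball_zero_iff]
        have : q' = (q' - q) + q := by abel
        rw [this]
        exact (norm_add_le _ _).trans_lt (by linarith)
    have h1 := hx q' (by linarith)
    have h2 : R q' - R q = x' - (xb + R q) := by rw [hx']; abel
    have h5 : ⟪u, q' - q⟫ = ⟪u, p' - (q - σ • R q)⟫ + σ * ⟪u, x' - (xb + R q)⟫ := by
      rw [hqq, inner_add_right, inner_smul_right]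
    rw [h2, h5] at h1
    show ⟪z - σ • u, x' - (xb + R q)⟫ + ⟪-u, p' - (q - σ • R q)⟫ ≤ e * D
    rw [inner_sub_left, inner_neg_left, inner_smul_left, conj_trivial]
    have h3 : A * ‖q' - q‖ ^ 2 ≤ A * ((1 + σ) * D) ^ 2 := by gcongr
    have h4 : A * ((1 + σ) * D) ^ 2 ≤ e * D := by
      calc A * ((1 + σ) * D) ^ 2 = A * (1 + σ) ^ 2 * D * D := by ring
        _ ≤ A * (1 + σ) ^ 2 * d * D := by gcongr
        _ ≤ e * D := by gcongr
    linarith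
/-- Theorem 4.9, (iii) ⟹ (i): the second-order conditions on the combined second-order
subdifferential imply tilt stability with modulus `κ`. -/
theorem second_order_conditions_imply_tilt_stability {X : Type*} [NormedAddCommGroup X] [InnerProductSpace ℝ X] [CompleteSpace X]
    (f : X → EReal)
    (hproper : ∃ x, f x ≠ ⊤) (hbot : ∀ x, f x ≠ ⊥) (hlsc : LowerSemicontinuous f)
    (xb : X) (h0 : (0 : X) ∈ LimitingSubdiff f xb)
    (hpr : ProxRegularAt f xb 0) (hsc : SubdiffContAt f xb 0)
    (κ : ℝ) (hκ : 0 < κ)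
    (η r : ℝ) (hη : 0 < η) (hr0 : 0 ≤ r) (hrκ : r < κ⁻¹)
    (hcond : ∀ x p : X, p ∈ LimitingSubdiff f x →
      (x, p) ∈ Metric.closedBall (xb, (0 : X)) η →
      ∀ u w : X, w ∈ CombinedSecondSubdiff f x p u →
        ‖u‖ ≤ κ * ‖w‖ ∧ -r * ‖u‖ ^ 2 ≤ ⟪w, u⟫) :
    TiltStableWith f xb κ := by
  obtain ⟨ρ, hρ, ε, hε, hεη, hPR⟩ := setup_loc f hbot xb hpr hsc η hη
  obtain ⟨δ, hδ, hδ1, hδ2⟩ : ∃ δ : ℝ, 0 < δ ∧ δ ≤ 1 / 16 ∧ δ * (8 * (ρ + 3)) ≤ ε := by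
    refine ⟨min (1 / 16) (ε / (8 * (ρ + 3))), lt_min (by norm_num) (by positivity),
      min_le_left _ _, ?_⟩
    rw [← le_div_iff₀ (by positivity)]
    exact min_le_right _ _
  have hσ : 0 < ρ + 2 := by positivity
  have hex : ∀ q : X, ∃ v : X, q ∈ ball (0 : X) δ → ‖v‖ ≤ ε / 2 ∧ ‖q - (ρ + 2) • v‖ ≤ ε / 2 ∧
      q - (ρ + 2) • v ∈ LimitingSubdiff f (xb + v) := by
    intro q
    by_cases hq : q ∈ ball (0 : X) δ
    · obtain ⟨x, h1, h2, h3⟩ := resolvent_exists f hbot hlsc xb h0 ρ ε hρ hε hPR δ hδ hδ1 hδ2 q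
        (mem_ball_zero_iff.1 hq)
      exact ⟨x - xb, fun _ => ⟨h1, h2, by rwa [add_sub_cancel]⟩⟩
    · exact ⟨0, fun h => absurd h hq⟩
  choose R hR using hex
  have hcb : ∀ q ∈ ball (0 : X) δ, xb + R q ∈ closedBall xb ε := by
    intro q hq
    rw [mem_closedBall, dist_eq_norm, add_sub_cancel_left]
    linarith [(hR q hq).1]
  have hid : ∀ x p : X, p ∈ LimitingSubdiff f x → ‖x - xb‖ ≤ ε → ‖p‖ ≤ ε →
      p + (ρ + 2) • (x - xb) ∈ ball (0 : X) δ → x = xb + R (p + (ρ + 2) • (x - xb)) := by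
    intro x p hp hx hpn hq
    obtain ⟨h1, h2, h3⟩ := hR _ hq
    have := mono_loc f xb ρ ε hPR (xb + R (p + (ρ + 2) • (x - xb))) x
      (p + (ρ + 2) • (x - xb)) (p + (ρ + 2) • (x - xb)) (hcb _ hq)
      (by rw [mem_closedBall, dist_eq_norm]; exact hx)
      (by rw [add_sub_cancel_left]; exact h3)
      (by rw [add_sub_cancel_right]; exact hp)
      (by rw [add_sub_cancel_left]; linarith)
      (by rw [add_sub_cancel_right]; exact hpn)
    rw [sub_self, norm_zero] at this
    have h4 : ‖x - (xb + R (p + (ρ + 2) • (x - xb)))‖ = 0 :=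
      le_antisymm (by linarith) (norm_nonneg _)
    exact sub_eq_zero.1 (norm_eq_zero.1 h4)
  have hR0 : R 0 = 0 := by
    have := hid xb 0 h0 (by simp [hε.le]) (by simp [hε.le]) (by simp [hδ])
    simpa using this
  have hK : ∀ q ∈ ball (0 : X) δ, ∀ q' ∈ ball (0 : X) δ,
      ‖R q' - R q‖ ≤ 1 / 2 * ‖q' - q‖ := by
    intro q hq q' hq'
    obtain ⟨h1, h2, h3⟩ := hR _ hq
    obtain ⟨h1', h2', h3'⟩ := hR _ hq'
    have := mono_loc f xb ρ ε hPR (xb + R q) (xb + R q') q q' (hcb _ hq) (hcb _ hq')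
      (by rw [add_sub_cancel_left]; exact h3)
      (by rw [add_sub_cancel_left]; exact h3')
      (by rw [add_sub_cancel_left]; linarith)
      (by rw [add_sub_cancel_left]; linarith)
    rw [add_sub_add_left_eq_sub] at this
    linarith
  obtain ⟨φ, hφdef⟩ : ∃ φ : X → ℝ, φ = fun q =>
    ⟪q, R q⟫ - (f (xb + R q)).toReal - (ρ + 2) / 2 * ‖R q‖ ^ 2 := ⟨_, rfl⟩
  have hF : ∀ q ∈ ball (0 : X) δ,
      f (xb + R q) = ((⟪q, R q⟫ - φ q - (ρ + 2) / 2 * ‖R q‖ ^ 2 : ℝ) : EReal) := by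
    intro q hq
    obtain ⟨h1, h2, h3⟩ := hR _ hq
    obtain ⟨fx, e, -⟩ := hPR _ (hcb q hq) _ h3 (by linarith)
    rw [hφdef]
    simp only [e, EReal.toReal_coe]
    congr 1
    ring
  have hB : ∀ q ∈ ball (0 : X) δ, ∀ y ∈ closedBall xb ε,
      ((⟪q, y - xb⟫ - φ q - (ρ + 2) / 2 * ‖y - xb‖ ^ 2 : ℝ) : EReal) ≤ f y := by
    intro q hq y hy
    obtain ⟨h1, h2, h3⟩ := hR _ hq
    obtain ⟨fx, e, h4⟩ := hPR _ (hcb q hq) _ h3 (by linarith)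
    have hfx := hF q hq
    rw [e, EReal.coe_eq_coe_iff] at hfx
    refine le_trans ?_ (h4 y hy)
    rw [EReal.coe_le_coe_iff]
    obtain ⟨w, hw⟩ : ∃ w, w = y - (xb + R q) := ⟨_, rfl⟩
    have hyw : y - xb = R q + w := by rw [hw]; abel
    rw [← hw, hyw, hfx, norm_add_sq_real]
    simp only [inner_add_right, inner_sub_left, inner_smul_left, conj_trivial]
    nlinarith [sq_nonneg ‖w‖]
  have hφ : ∀ q ∈ ball (0 : X) δ, ∀ q' ∈ ball (0 : X) δ, φ q + ⟪R q, q' - q⟫ ≤ φ q' := by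
    intro q hq q' hq'
    have h := hB q' hq' _ (hcb q hq)
    rw [hF q hq, EReal.coe_le_coe_iff, add_sub_cancel_left] at h
    rw [inner_sub_right, real_inner_comm q' (R q), real_inner_comm q (R q)]
    linarith
  have hsec := hsec_of f xb R ε δ (ρ + 2) κ η r hε hδ hσ hεη hR hid hcond
  have hL := bootstrap R φ δ hφ (1 / 2) (by norm_num) hK κ (ρ + 2) r hκ hσ.le hrκ hsec
  have hD := descent R φ (ball 0 δ) (convex_ball _ _) _ hφ hL
  refine tilt_of_growth f xb R ε δ (ρ + 2) κ hε hδ hσ hκ hR0 ?_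
    (growth_of_lip f xb R φ ε δ (ρ + 2) κ hσ hκ hF hB hD)
  intro q hq q' hq'
  have h1 := hL q hq q' hq'
  have h2 : (ρ + 2 + κ⁻¹) * (κ / (1 + κ * (ρ + 2))) = 1 := by
    have : 1 + κ * (ρ + 2) ≠ 0 := by positivity
    field_simp
    ring
  calc (ρ + 2 + κ⁻¹) * ‖R q' - R q‖
      ≤ (ρ + 2 + κ⁻¹) * (κ / (1 + κ * (ρ + 2)) * ‖q' - q‖) := by gcongr
    _ = ‖q' - q‖ := by rw [← mul_assoc, h2, one_mul]
end
end

section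
/- Define f : ℝ² → ℝ ∪ {+∞} by f(x₁, x₂) = x₁² − x₂² + δ_Ω(x₁, x₂), where Ω = {(x₁, x₂) ∈ ℝ² : −x₁ + x₂ ≤ 0 and −x₁ − x₂ ≤ 0} and δ_Ω is the indicator function of Ω (equal to 0 on Ω and +∞ otherwise). Then x̄ = (0, 0) is a local minimizer of f with 0 ∈ ∂f(x̄), and the vector (0, −2) belongs to ∂²f(x̄, 0)((0, 1)); consequently, there exist u ≠ 0 and u* ∈ ∂²f(x̄, 0)(u) with ⟨u*, u⟩ = −2 < 0, so the positive-semidefiniteness of the generalized Hessian ∂²f(x̄, 0) fails at this local minimizer. -/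
open Filter Metric Topology RealInnerProductSpace

noncomputable section

/-- The Euclidean pairing on `ℝ × ℝ`. -/
def pairP (p q : ℝ × ℝ) : ℝ := p.1 * q.1 + p.2 * q.2

/-- The regular/Fréchet subdifferential of `f : ℝ × ℝ → EReal` at `x`. -/
def FrechetSubdiffP (f : ℝ × ℝ → EReal) (x : ℝ × ℝ) : Set (ℝ × ℝ) :=
  {p | f x ≠ ⊤ ∧ ∀ ε : ℝ, 0 < ε → ∃ δ : ℝ, 0 < δ ∧
    ∀ y : ℝ × ℝ, dist y x < δ →
      f x + ((pairP p (y - x) - ε * dist y x : ℝ) : EReal) ≤ f y}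

/-- The limiting subdifferential of `f : ℝ × ℝ → EReal` at `x`. -/
def LimitingSubdiffP (f : ℝ × ℝ → EReal) (x : ℝ × ℝ) : Set (ℝ × ℝ) :=
  {p | ∃ (xs ps : ℕ → ℝ × ℝ),
    (∀ k, ps k ∈ FrechetSubdiffP f (xs k)) ∧
    Tendsto xs atTop (𝓝 x) ∧
    Tendsto (fun k => f (xs k)) atTop (𝓝 (f x)) ∧
    Tendsto ps atTop (𝓝 p)}

/-- The Fréchet/regular normal cone to a subset of `(ℝ × ℝ) × (ℝ × ℝ)`. -/
def FrechetNormalPP (Ω : Set ((ℝ × ℝ) × (ℝ × ℝ))) (zb : (ℝ × ℝ) × (ℝ × ℝ)) :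
    Set ((ℝ × ℝ) × (ℝ × ℝ)) :=
  {w | ∀ ε : ℝ, 0 < ε → ∃ δ : ℝ, 0 < δ ∧ ∀ z ∈ Ω, dist z zb < δ →
    pairP w.1 (z.1 - zb.1) + pairP w.2 (z.2 - zb.2) ≤ ε * dist z zb}

/-- The limiting/Mordukhovich normal cone to a subset of `(ℝ × ℝ) × (ℝ × ℝ)`. -/
def LimitingNormalPP (Ω : Set ((ℝ × ℝ) × (ℝ × ℝ))) (zb : (ℝ × ℝ) × (ℝ × ℝ)) :
    Set ((ℝ × ℝ) × (ℝ × ℝ)) :=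
  {w | ∃ (zs ws : ℕ → (ℝ × ℝ) × (ℝ × ℝ)),
    (∀ k, zs k ∈ Ω ∧ ws k ∈ FrechetNormalPP Ω (zs k)) ∧
    Tendsto zs atTop (𝓝 zb) ∧ Tendsto ws atTop (𝓝 w)}

/-- The second-order subdifferential (generalized Hessian) of `f : ℝ × ℝ → EReal`. -/
def SecondSubdiffP (f : ℝ × ℝ → EReal) (xb pb u : ℝ × ℝ) : Set (ℝ × ℝ) :=
  {w | (w, -u) ∈ LimitingNormalPP
    {q : (ℝ × ℝ) × (ℝ × ℝ) | q.2 ∈ LimitingSubdiffP f q.1} (xb, pb)}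

/-- The function of Example 4.13. -/
def amenableFun : ℝ × ℝ → EReal := fun x =>
  if -x.1 + x.2 ≤ 0 ∧ -x.1 - x.2 ≤ 0 then ((x.1 ^ 2 - x.2 ^ 2 : ℝ) : EReal) else ⊤

theorem aux_val {x : ℝ × ℝ} (h1 : -x.1 + x.2 ≤ 0) (h2 : -x.1 - x.2 ≤ 0) :
    amenableFun x = ((x.1 ^ 2 - x.2 ^ 2 : ℝ) : EReal) := by
  unfold amenableFun
  rw [if_pos ⟨h1, h2⟩]

theorem aux_grad {x : ℝ × ℝ} (h1 : -x.1 + x.2 ≤ 0) (h2 : -x.1 - x.2 ≤ 0) :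
    ((2 * x.1, -2 * x.2) : ℝ × ℝ) ∈ FrechetSubdiffP amenableFun x := by
  refine ⟨by rw [aux_val h1 h2]; exact EReal.coe_ne_top _, fun ε hε => ⟨ε, hε, fun y hy => ?_⟩⟩
  by_cases hy' : -y.1 + y.2 ≤ 0 ∧ -y.1 - y.2 ≤ 0
  · rw [aux_val h1 h2, aux_val hy'.1 hy'.2, ← EReal.coe_add, EReal.coe_le_coe_iff]
    have hb : |y.2 - x.2| ≤ dist y x := by
      rw [← Real.dist_eq, Prod.dist_eq]; exact le_max_right _ _
    have h0 : (0 : ℝ) ≤ dist y x := dist_nonneg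
    have hs : (y.2 - x.2) ^ 2 ≤ dist y x * dist y x := by
      rw [← sq_abs, sq]; exact mul_le_mul hb hb (abs_nonneg _) h0
    simp only [pairP, Prod.fst_sub, Prod.snd_sub]
    nlinarith [sq_nonneg (y.1 - x.1), mul_le_mul_of_nonneg_right hy.le h0]
  · have : amenableFun y = ⊤ := by unfold amenableFun; rw [if_neg hy']
    rw [this]; exact le_top

theorem aux_dir {x p : ℝ × ℝ} (h1 : -x.1 + x.2 < 0) (h2 : -x.1 - x.2 < 0)
    (hp : p ∈ FrechetSubdiffP amenableFun x) (a b : ℝ) (ha : |a| ≤ 1) (hb : |b| ≤ 1) :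
    p.1 * a + p.2 * b ≤ 2 * x.1 * a - 2 * x.2 * b := by
  refine le_of_forall_pos_le_add fun ε hε => ?_
  obtain ⟨δ, hδ, H⟩ := hp.2 (ε / 2) (half_pos hε)
  obtain ⟨t, ht, ht'⟩ : ∃ t : ℝ, 0 < t ∧
      t < min (min δ (ε / 2)) (min ((x.1 - x.2) / 2) ((x.1 + x.2) / 2)) :=
    exists_between (lt_min (lt_min hδ (half_pos hε)) (lt_min (by linarith) (by linarith)))
  obtain ⟨⟨t1, t2⟩, t3, t4⟩ := by simpa only [lt_min_iff] using ht'
  obtain ⟨a1, a2⟩ := abs_le.1 ha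
  obtain ⟨b1, b2⟩ := abs_le.1 hb
  have hd : dist ((x.1 + t * a, x.2 + t * b) : ℝ × ℝ) x ≤ t := by
    rw [Prod.dist_eq, Real.dist_eq, Real.dist_eq]
    simp only [add_sub_cancel_left, abs_mul, abs_of_pos ht]
    exact max_le (by nlinarith) (by nlinarith)
  have := H (x.1 + t * a, x.2 + t * b) (hd.trans_lt t1)
  rw [aux_val h1.le h2.le, aux_val (by simp only; nlinarith) (by simp only; nlinarith),
    ← EReal.coe_add, EReal.coe_le_coe_iff] at this
  simp only [pairP, Prod.fst_sub, Prod.snd_sub, add_sub_cancel_left] at this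
  have hd2 := mul_le_mul_of_nonneg_left hd (half_pos hε).le
  have haa : a ^ 2 ≤ 1 := by nlinarith
  have key : t * (p.1 * a + p.2 * b) ≤ t * (2 * x.1 * a - 2 * x.2 * b + ε) := by
    nlinarith [mul_le_mul_of_nonneg_left haa (sq_nonneg t), sq_nonneg (t * b),
      mul_le_mul_of_nonneg_left t2.le ht.le]
  exact le_of_mul_le_mul_left key ht

theorem aux_uniq {x p : ℝ × ℝ} (h1 : -x.1 + x.2 < 0) (h2 : -x.1 - x.2 < 0)
    (hp : p ∈ FrechetSubdiffP amenableFun x) : p = (2 * x.1, -2 * x.2) := by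
  have e1 := aux_dir h1 h2 hp 1 0 (by simp) (by simp)
  have e2 := aux_dir h1 h2 hp (-1) 0 (by simp) (by simp)
  have e3 := aux_dir h1 h2 hp 0 1 (by simp) (by simp)
  have e4 := aux_dir h1 h2 hp 0 (-1) (by simp) (by simp)
  ext <;> simp only <;> linarith

theorem aux_open : IsOpen {x : ℝ × ℝ | -x.1 + x.2 < 0 ∧ -x.1 - x.2 < 0} := by
  have h1 : IsOpen {x : ℝ × ℝ | -x.1 + x.2 < 0} := isOpen_lt (by fun_prop) (by fun_prop)
  have h2 : IsOpen {x : ℝ × ℝ | -x.1 - x.2 < 0} := isOpen_lt (by fun_prop) (by fun_prop)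
  exact h1.inter h2

theorem aux_uniq_lim {x p : ℝ × ℝ} (h1 : -x.1 + x.2 < 0) (h2 : -x.1 - x.2 < 0)
    (hp : p ∈ LimitingSubdiffP amenableFun x) : p = (2 * x.1, -2 * x.2) := by
  obtain ⟨xs, ps, hF, hx, -, hps⟩ := hp
  have hev : ∀ᶠ k in atTop, ((2 * (xs k).1, -2 * (xs k).2) : ℝ × ℝ) = ps k := by
    filter_upwards [hx (aux_open.mem_nhds ⟨h1, h2⟩)] with k hk
    exact (aux_uniq hk.1 hk.2 (hF k)).symm
  have hc : Continuous fun z : ℝ × ℝ => ((2 * z.1, -2 * z.2) : ℝ × ℝ) := by fun_prop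
  exact tendsto_nhds_unique hps (((hc.tendsto x).comp hx).congr' hev)

theorem aux_grad_lim {x : ℝ × ℝ} (h1 : -x.1 + x.2 ≤ 0) (h2 : -x.1 - x.2 ≤ 0) :
    ((2 * x.1, -2 * x.2) : ℝ × ℝ) ∈ LimitingSubdiffP amenableFun x :=
  ⟨fun _ => x, fun _ => (2 * x.1, -2 * x.2), fun _ => aux_grad h1 h2,
    tendsto_const_nhds, tendsto_const_nhds, tendsto_const_nhds⟩

theorem aux_second :
    ((0, -2) : ℝ × ℝ) ∈ SecondSubdiffP amenableFun (0, 0) (0, 0) ((0, 1) : ℝ × ℝ) := by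
  have hpos : ∀ k : ℕ, (0 : ℝ) < 1 / ((k : ℝ) + 1) := fun k => Nat.one_div_pos_of_nat
  refine ⟨fun k => ((1 / ((k : ℝ) + 1), 0), (2 * (1 / ((k : ℝ) + 1)), -2 * 0)),
    fun _ => ((0, -2), -(0, 1)), fun k => ⟨?_, ?_⟩, ?_, tendsto_const_nhds⟩
  · have := hpos k
    exact aux_grad_lim (x := (1 / ((k : ℝ) + 1), 0)) (by simp only; linarith)
      (by simp only; linarith)
  · intro ε hε
    have := hpos k
    obtain ⟨δ, hδ, hb⟩ := Metric.isOpen_iff.1 aux_open (1 / ((k : ℝ) + 1), 0)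
      ⟨by simp only; linarith, by simp only; linarith⟩
    refine ⟨δ, hδ, fun z hz hd => ?_⟩
    have hz1 := hb (show z.1 ∈ ball _ δ from lt_of_le_of_lt (le_max_left _ _) hd)
    have e := aux_uniq_lim hz1.1 hz1.2 hz
    have e2 : z.2.2 = -2 * z.1.2 := by rw [e]
    have h0 := mul_nonneg hε.le (dist_nonneg (x := z)
      (y := (((1 / ((k : ℝ) + 1), 0), (2 * (1 / ((k : ℝ) + 1)), -2 * 0)) : (ℝ × ℝ) × (ℝ × ℝ))))
    refine le_trans (le_of_eq ?_) h0
    simp only [pairP, Prod.fst_sub, Prod.snd_sub, Prod.fst_neg, Prod.snd_neg, e2]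
    ring
  · have ht := tendsto_one_div_add_atTop_nhds_zero_nat (𝕜 := ℝ)
    have hc : Continuous fun t : ℝ => (((t, 0), (2 * t, -2 * 0)) : (ℝ × ℝ) × (ℝ × ℝ)) := by
      fun_prop
    have := (hc.tendsto 0).comp ht
    simpa [Function.comp_def] using this

/-- Example 4.13: positive-semidefiniteness of the generalized Hessian is not necessary
for local optimality. -/
theorem hessian_semidefiniteness_not_necessary :
    (∃ U ∈ 𝓝 ((0, 0) : ℝ × ℝ), ∀ x ∈ U, amenableFun (0, 0) ≤ amenableFun x) ∧
    ((0, 0) : ℝ × ℝ) ∈ LimitingSubdiffP amenableFun (0, 0) ∧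
    ((0, -2) : ℝ × ℝ) ∈ SecondSubdiffP amenableFun (0, 0) (0, 0) ((0, 1) : ℝ × ℝ) ∧
    (∃ u w : ℝ × ℝ, u ≠ 0 ∧ w ∈ SecondSubdiffP amenableFun (0, 0) (0, 0) u ∧
      pairP w u = -2 ∧ pairP w u < 0) := by
  refine ⟨⟨Set.univ, univ_mem, fun x _ => ?_⟩, ?_, aux_second,
    (0, 1), (0, -2), ?_, aux_second, ?_, ?_⟩
  · by_cases hx : -x.1 + x.2 ≤ 0 ∧ -x.1 - x.2 ≤ 0
    · rw [aux_val hx.1 hx.2, aux_val (by simp) (by simp), EReal.coe_le_coe_iff]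
      simp only
      nlinarith [mul_nonneg_of_nonpos_of_nonpos hx.1 hx.2]
    · have : amenableFun x = ⊤ := by unfold amenableFun; rw [if_neg hx]
      rw [this]; exact le_top
  · simpa using aux_grad_lim (x := (0, 0)) (by simp) (by simp)
  · simp
  · norm_num [pairP]
  · norm_num [pairP]
end
end
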